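/- arXiv:2502.09343 — 2 statements merged into one kernel-verified Lean document; each statement's English description precedes it below -/
import Mathlib

section
/- Let h and n be non-negative integers with n ≥ h and h+n odd, and let k_1 ≤ k_2 ≤ … ≤ k_n be integers. Let F ∈ ℚ[k_1,…,k_{n+1}] be the Pfaffian of the upper triangular array of order n+1+h with entries F_{i,j} = gt_h(k_i+i, k_j+j) for 1 ≤ i < j ≤ n+1, F_{i,n+1+j} = binom(k_i+i, h−j) for 1 ≤ i ≤ n+1 and 1 ≤ j ≤ h, and F_{n+1+i,n+1+j} = 0 for 1 ≤ i < j ≤ h. Then for every integer value of k_{n+1}, GT_h(k_1,…,k_n) = (Δ_{k_{n+1}}^h F)(k_1,…,k_n,k_{n+1}), where Δ_{k_{n+1}} is the forward difference in the last variable. -/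
open MvPolynomial

noncomputable section

/-- The generalized binomial coefficient `binom(x,m) = x(x-1)⋯(x-m+1)/m!`. -/
def qbinom (x : ℚ) (m : ℕ) : ℚ := (∏ j ∈ Finset.range m, (x - j)) / m.factorial

/-- The generalized binomial coefficient `binom(q,m)` of a polynomial `q`. -/
def pbinom {σ : Type*} (q : MvPolynomial σ ℚ) (m : ℕ) : MvPolynomial σ ℚ :=
  ((m.factorial : ℚ)⁻¹) • ∏ j ∈ Finset.range m, (q - (j : MvPolynomial σ ℚ))

/-- `gtChar gt` says that `gt h` is the (unique) bivariate polynomial `gt_h(x,y)`. -/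
def gtChar (gt : ℕ → MvPolynomial (Fin 2) ℚ) : Prop :=
  gt 0 = 1 ∧
    ∀ h : ℕ, 1 ≤ h → ∀ x y : ℤ, (h : ℤ) ≤ x →
      MvPolynomial.eval ![(x : ℚ), (y : ℚ)] (gt h) =
        ∑ p ∈ Finset.Icc (h : ℤ) (x - 1),
          (qbinom ((x : ℚ) - (p : ℚ) + (h : ℚ) - 1) h * qbinom ((y : ℚ) - (p : ℚ) + (h : ℚ) - 2) h -
            qbinom ((x : ℚ) - (p : ℚ) + (h : ℚ) - 2) h * qbinom ((y : ℚ) - (p : ℚ) + (h : ℚ) - 1) h)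

/-- Skew-symmetric extension of an upper triangular array. -/
def skewExt {R : Type*} [Ring R] {N : ℕ} (A : Fin N → Fin N → R) : Fin N → Fin N → R :=
  fun i j => if i < j then A i j else if j < i then -A j i else 0

/-- The Pfaffian of an upper triangular array of (even) order `N`. -/
def pfUpper {R : Type*} [CommRing R] [Algebra ℚ R] (N : ℕ) (A : Fin N → Fin N → R) : R :=
  ((2 ^ (N / 2) * (N / 2).factorial : ℚ)⁻¹) •
    ∑ σ : Equiv.Perm (Fin N),
      (Equiv.Perm.sign σ : ℤ) •
        ∏ i : Fin (N / 2),
          skewExt A (σ ⟨2 * i.val, by have := i.isLt; omega⟩)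
            (σ ⟨2 * i.val + 1, by have := i.isLt; omega⟩)

/-- Index set of an `(h,n)`-trapezoidal array. -/
def GTIdx (h n : ℕ) : Type := {p : ℕ × ℕ // p.1 ≤ h ∧ p.2 < n - h + p.1}

def mkIdx (h n r c : ℕ) (hr : r ≤ h) (hc : c < n - h + r) : GTIdx h n := ⟨(r, c), hr, hc⟩

/-- The Gelfand–Tsetlin trapezoid conditions. -/
def IsGT (h n : ℕ) (a : GTIdx h n → ℤ) : Prop :=
  ∀ (r c : ℕ) (_ : r < h) (hc : c < n - h + r),
    a (mkIdx h n (r+1) c (by omega) (by omega)) ≤ a (mkIdx h n r c (by omega) hc) ∧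
    a (mkIdx h n r c (by omega) hc) ≤ a (mkIdx h n (r+1) (c+1) (by omega) (by omega))

/-- The number of `(h,n)`-Gelfand–Tsetlin trapezoids with prescribed bottom row `k`. -/
def GTcount (h n : ℕ) (k : Fin n → ℤ) : ℕ :=
  Nat.card {a : GTIdx h n → ℤ //
    IsGT h n a ∧ ∀ i : Fin n, a (mkIdx h n h i.val le_rfl (by have := i.isLt; omega)) = k i}

/-- The shift operator `E_s` on polynomials: substitute `X s + 1` for `X s`. -/
def shiftF {σ : Type*} [DecidableEq σ] (s : σ) (p : MvPolynomial σ ℚ) : MvPolynomial σ ℚ :=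
  MvPolynomial.aeval (fun t => if t = s then MvPolynomial.X t + 1 else MvPolynomial.X t) p

/-- The forward difference operator `Δ_s = E_s - id`. -/
def fdiffF {σ : Type*} [DecidableEq σ] (s : σ) (p : MvPolynomial σ ℚ) : MvPolynomial σ ℚ :=
  shiftF s p - p

section PairedSum

open Equiv

variable {R : Type*} [CommRing R] {ι : Type*} [Fintype ι] [DecidableEq ι]

/-- The unnormalized Pfaffian: the signed sum over all permutations of `ι ⊕ ι` of the products
of the entries indexed by the images of the pairs `(inl i, inr i)`. -/
def pfSum (A : ι ⊕ ι → ι ⊕ ι → R) : R :=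
  ∑ σ : Perm (ι ⊕ ι), ((Perm.sign σ : ℤ) : R) * ∏ i, A (σ (Sum.inl i)) (σ (Sum.inr i))

/-- Distributivity of a product of double sums over pairs. -/
lemma sum_piFinset_prod_pairs {α : Type*} (t : ι ⊕ ι → Finset α) (w : ι ⊕ ι → α → R)
    (H : ι → α → α → R) :
    ∑ g ∈ Fintype.piFinset t, (∏ v, w v (g v)) * ∏ i, H i (g (Sum.inl i)) (g (Sum.inr i)) =
      ∏ i, ∑ x ∈ t (Sum.inl i), ∑ y ∈ t (Sum.inr i),
        w (Sum.inl i) x * w (Sum.inr i) y * H i x y := by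
  simp_rw [← Finset.sum_product']
  rw [Finset.prod_univ_sum]
  refine Finset.sum_nbij' (fun g i => (g (Sum.inl i), g (Sum.inr i)))
    (fun p => Sum.elim (fun i => (p i).1) (fun i => (p i).2)) ?_ ?_ ?_ ?_ ?_
  · intro g hg
    simp only [Fintype.mem_piFinset, Finset.mem_product] at hg ⊢
    exact fun i => ⟨hg _, hg _⟩
  · intro p hp
    simp only [Fintype.mem_piFinset, Finset.mem_product] at hp ⊢
    rintro (i | i)
    exacts [(hp i).1, (hp i).2]
  · intro g _
    funext v
    cases v <;> rfl
  · intro p _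
    rfl
  · intro g _
    simp only [Fintype.prod_sum_type, Finset.prod_mul_distrib]

lemma pfSum_sum {α : Type*} (t : ι ⊕ ι → Finset α) (w : ι ⊕ ι → α → R)
    (G : ι ⊕ ι → ι ⊕ ι → α → α → R) :
    ∑ a ∈ Fintype.piFinset t, (∏ v, w v (a v)) * pfSum (fun u v => G u v (a u) (a v)) =
      pfSum (fun u v => ∑ x ∈ t u, ∑ y ∈ t v, w u x * w v y * G u v x y) := by
  simp only [pfSum, Finset.mul_sum]
  rw [Finset.sum_comm]
  refine Finset.sum_congr rfl fun σ _ => ?_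
  rw [← sum_piFinset_prod_pairs (fun v => t (σ v)) (fun v => w (σ v))
    (fun i => G (σ (Sum.inl i)) (σ (Sum.inr i))), Finset.mul_sum]
  refine Finset.sum_nbij' (fun a v => a (σ v)) (fun b v => b (σ.symm v)) ?_ ?_ ?_ ?_ ?_
  · intro a ha
    simp only [Fintype.mem_piFinset] at ha ⊢
    exact fun v => ha _
  · intro b hb
    simp only [Fintype.mem_piFinset] at hb ⊢
    intro v
    simpa using hb (σ.symm v)
  · intro a _
    simp
  · intro b _
    simp
  · intro a _
    rw [← Equiv.prod_comp σ (fun v => w v (a v))]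
    ring

/-- The Pfaffian of a congruent matrix. -/
lemma pfSum_congruence (A : ι ⊕ ι → ι ⊕ ι → R) (B : Matrix (ι ⊕ ι) (ι ⊕ ι) R) :
    pfSum (fun u v => ∑ p, ∑ q, B u p * B v q * A p q) = B.det * pfSum A := by
  have expand : ∀ σ : Perm (ι ⊕ ι),
      ∏ i, ∑ p, ∑ q, B (σ (Sum.inl i)) p * B (σ (Sum.inr i)) q * A p q =
        ∑ g : ι ⊕ ι → ι ⊕ ι, (∏ v, B (σ v) (g v)) * ∏ i, A (g (Sum.inl i)) (g (Sum.inr i)) := by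
    intro σ
    have key := sum_piFinset_prod_pairs (fun _ => Finset.univ) (fun v x => B (σ v) x)
      (fun _ : ι => A)
    rw [Fintype.piFinset_univ] at key
    rw [key]
  have det_sub : ∀ g : ι ⊕ ι → ι ⊕ ι,
      ∑ σ : Perm (ι ⊕ ι), ((Perm.sign σ : ℤ) : R) * ∏ v, B (σ v) (g v) =
        (B.submatrix id g).det := by
    intro g
    rw [Matrix.det_apply']
    rfl
  calc pfSum (fun u v => ∑ p, ∑ q, B u p * B v q * A p q)
      = ∑ g : ι ⊕ ι → ι ⊕ ι,
          (B.submatrix id g).det * ∏ i, A (g (Sum.inl i)) (g (Sum.inr i)) := by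
        simp only [pfSum, expand, Finset.mul_sum]
        rw [Finset.sum_comm]
        refine Finset.sum_congr rfl fun g _ => ?_
        rw [← det_sub, Finset.sum_mul]
        refine Finset.sum_congr rfl fun σ _ => ?_
        ring
    _ = B.det * pfSum A := by
        rw [pfSum, Finset.mul_sum]
        symm
        refine Finset.sum_of_injOn (fun σ : Perm (ι ⊕ ι) => (σ : ι ⊕ ι → ι ⊕ ι)) ?_ ?_ ?_ ?_
        · exact DFunLike.coe_injective.injOn
        · intro _ _
          simp
        · intro g _ hg
          have hinj : ¬ Function.Injective g := by
            intro hi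
            refine hg ⟨Equiv.ofBijective g ⟨hi, Finite.surjective_of_injective hi⟩, ?_, rfl⟩
            simp
          simp only [Function.Injective, not_forall] at hinj
          obtain ⟨u, v, huv, hne⟩ := hinj
          rw [Matrix.det_zero_of_column_eq hne, zero_mul]
          intro k
          simp [huv]
        · intro σ _
          rw [Matrix.det_permute']
          ring

/-- The summand of `pfSum` is unchanged by permuting the pairs. -/
lemma pfSum_term_mul_sumCongr (A : ι ⊕ ι → ι ⊕ ι → R) (σ : Perm (ι ⊕ ι)) (τ : Perm ι) :
    ((Perm.sign (σ * Perm.sumCongr τ τ) : ℤ) : R) *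
        ∏ i, A ((σ * Perm.sumCongr τ τ) (Sum.inl i)) ((σ * Perm.sumCongr τ τ) (Sum.inr i)) =
      ((Perm.sign σ : ℤ) : R) * ∏ i, A (σ (Sum.inl i)) (σ (Sum.inr i)) := by
  rw [Perm.sign_mul, Perm.sign_sumCongr, Int.units_mul_self, mul_one,
    ← Equiv.prod_comp τ (fun i => A (σ (Sum.inl i)) (σ (Sum.inr i)))]
  simp

/-- The summand of `pfSum` for a skew-symmetric matrix is unchanged by flipping a pair. -/
lemma pfSum_term_mul_swap (A : ι ⊕ ι → ι ⊕ ι → R) (hA : ∀ u v, A u v = -A v u)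
    (σ : Perm (ι ⊕ ι)) (j : ι) :
    ((Perm.sign (σ * swap (Sum.inl j) (Sum.inr j)) : ℤ) : R) *
        ∏ i, A ((σ * swap (Sum.inl j) (Sum.inr j)) (Sum.inl i))
          ((σ * swap (Sum.inl j) (Sum.inr j)) (Sum.inr i)) =
      ((Perm.sign σ : ℤ) : R) * ∏ i, A (σ (Sum.inl i)) (σ (Sum.inr i)) := by
  rw [Perm.sign_mul, Perm.sign_swap (by simp)]
  rw [← Finset.mul_prod_erase _ _ (Finset.mem_univ j),
    ← Finset.mul_prod_erase _ (fun i => A (σ (Sum.inl i)) (σ (Sum.inr i))) (Finset.mem_univ j)]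
  rw [Finset.prod_congr rfl (g := fun i => A (σ (Sum.inl i)) (σ (Sum.inr i)))]
  · simp only [Perm.mul_apply, swap_apply_left, swap_apply_right]
    rw [hA (σ (Sum.inr j))]
    push_cast
    ring
  · intro i hi
    have hij := (Finset.mem_erase.mp hi).1
    simp only [Perm.mul_apply]
    rw [swap_apply_of_ne_of_ne (by simpa using hij) (by simp),
      swap_apply_of_ne_of_ne (by simp) (by simpa using hij)]

lemma pfSum_reindex {κ : Type*} [Fintype κ] [DecidableEq κ] (e : ι ≃ κ)
    (A : κ ⊕ κ → κ ⊕ κ → R) :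
    pfSum (fun u v => A (Sum.map e e u) (Sum.map e e v)) = pfSum A := by
  unfold pfSum
  refine Fintype.sum_equiv (Equiv.permCongr (Equiv.sumCongr e e)) _ _ fun σ => ?_
  rw [Perm.sign_permCongr, ← Equiv.prod_comp e]
  simp [Equiv.permCongr_apply]

/-- Restriction of the sum to permutations fixing a distinguished pair. -/
lemma sum_fix_pair (A : Option ι ⊕ Option ι → Option ι ⊕ Option ι → R)
    (hrow : ∀ v, v ≠ Sum.inr none → A (Sum.inl none) v = 0) :
    ∑ σ : Perm (Option ι ⊕ Option ι) with σ (Sum.inl none) = Sum.inl none,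
        ((Perm.sign σ : ℤ) : R) * ∏ i, A (σ (Sum.inl i)) (σ (Sum.inr i)) =
      A (Sum.inl none) (Sum.inr none) *
        pfSum (fun u v : ι ⊕ ι => A (Sum.map some some u) (Sum.map some some v)) := by
  classical
  have hinj : Function.Injective (Sum.map some some : ι ⊕ ι → Option ι ⊕ Option ι) :=
    (Option.some_injective _).sumMap (Option.some_injective _)
  let f := Equiv.ofInjective _ hinj
  have hf : ∀ (τ : Perm (ι ⊕ ι)) u,
      τ.extendDomain f (Sum.map some some u) = Sum.map some some (τ u) := fun τ u =>
    τ.extendDomain_apply_image f u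
  have hl : ∀ τ : Perm (ι ⊕ ι), τ.extendDomain f (Sum.inl none) = Sum.inl none := fun τ =>
    τ.extendDomain_apply_not_subtype f (by rintro ⟨u | u, hu⟩ <;> simp at hu)
  have hr : ∀ τ : Perm (ι ⊕ ι), τ.extendDomain f (Sum.inr none) = Sum.inr none := fun τ =>
    τ.extendDomain_apply_not_subtype f (by rintro ⟨u | u, hu⟩ <;> simp at hu)
  unfold pfSum
  rw [Finset.mul_sum]
  symm
  refine Finset.sum_of_injOn (fun τ : Perm (ι ⊕ ι) => τ.extendDomain f) ?_ ?_ ?_ ?_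
  · exact (Perm.extendDomainHom_injective f).injOn
  · intro τ _
    simp [hl]
  · intro σ hσ hnot
    have h0 : σ (Sum.inl none) = Sum.inl none := by simpa using hσ
    by_cases h1 : σ (Sum.inr none) = Sum.inr none
    · exfalso
      apply hnot
      have hp : ∀ v, σ v ∈ Set.range (Sum.map some some : ι ⊕ ι → _) ↔
          v ∈ Set.range (Sum.map some some : ι ⊕ ι → _) := by
        have hmem : ∀ v : Option ι ⊕ Option ι,
            v ∈ Set.range (Sum.map some some : ι ⊕ ι → _) ↔
              v ≠ Sum.inl none ∧ v ≠ Sum.inr none := by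
          rintro ((_ | v) | (_ | v)) <;> simp
        intro v
        have hl' : σ v = Sum.inl none ↔ v = Sum.inl none := by
          conv_lhs => rw [← h0]
          exact σ.injective.eq_iff
        have hr' : σ v = Sum.inr none ↔ v = Sum.inr none := by
          conv_lhs => rw [← h1]
          exact σ.injective.eq_iff
        rw [hmem, hmem, Ne, Ne, hl', hr']
      refine ⟨f.permCongr.symm (σ.subtypePerm hp), by simp, ?_⟩
      ext1 v
      by_cases hv : v ∈ Set.range (Sum.map some some : ι ⊕ ι → _)
      · obtain ⟨u, rfl⟩ := hv
        simp only [hf]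
        have : ((f (f.permCongr.symm (σ.subtypePerm hp) u)) : Option ι ⊕ Option ι) =
            σ (f u) := by simp [Equiv.permCongr_symm, Equiv.permCongr_apply]
        exact this
      · have hmem : v = Sum.inl none ∨ v = Sum.inr none := by
          rcases v with (_ | v) | (_ | v) <;> simp at hv ⊢
        rcases hmem with rfl | rfl
        · simp only [hl, h0]
        · simp only [hr, h1]
    · rw [Finset.prod_eq_zero (Finset.mem_univ none), mul_zero]
      rw [h0]
      exact hrow _ h1
  · intro τ _
    simp only
    rw [Perm.sign_extendDomain, Fintype.prod_option, hl, hr]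
    have := fun i => hf τ (Sum.inl i)
    simp only [Sum.map_inl] at this
    simp only [this]
    have := fun i => hf τ (Sum.inr i)
    simp only [Sum.map_inr] at this
    simp only [this]
    ring

lemma pfSum_option (A : Option ι ⊕ Option ι → Option ι ⊕ Option ι → R)
    (hA : ∀ u v, A u v = -A v u)
    (hrow : ∀ v, v ≠ Sum.inr none → A (Sum.inl none) v = 0) :
    pfSum A = (2 * (Fintype.card ι + 1) : R) * (A (Sum.inl none) (Sum.inr none) *
        pfSum (fun u v : ι ⊕ ι => A (Sum.map some some u) (Sum.map some some v))) := by
  rw [← sum_fix_pair A hrow, pfSum,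
    ← Finset.sum_fiberwise Finset.univ (fun σ : Perm (Option ι ⊕ Option ι) => σ⁻¹ (Sum.inl none))]
  have transport : ∀ (s s' : Option ι ⊕ Option ι) (ρ : Perm (Option ι ⊕ Option ι)), ρ s' = s →
      (∀ σ : Perm (Option ι ⊕ Option ι), ((Perm.sign (σ * ρ) : ℤ) : R) *
          ∏ i, A ((σ * ρ) (Sum.inl i)) ((σ * ρ) (Sum.inr i)) =
        ((Perm.sign σ : ℤ) : R) * ∏ i, A (σ (Sum.inl i)) (σ (Sum.inr i))) →
      ∑ σ : Perm (Option ι ⊕ Option ι) with σ s = Sum.inl none,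
          ((Perm.sign σ : ℤ) : R) * ∏ i, A (σ (Sum.inl i)) (σ (Sum.inr i)) =
        ∑ σ : Perm (Option ι ⊕ Option ι) with σ s' = Sum.inl none,
          ((Perm.sign σ : ℤ) : R) * ∏ i, A (σ (Sum.inl i)) (σ (Sum.inr i)) := by
    intro s s' ρ hρ hinv
    refine Finset.sum_nbij' (fun σ => σ * ρ) (fun σ => σ * ρ⁻¹) ?_ ?_ ?_ ?_ ?_
    · intro σ hσ
      simpa [hρ] using hσ
    · intro σ hσ
      have : ρ.symm s = s' := by rw [← hρ]; simp
      simpa [this] using hσ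
    · intro σ _
      simp
    · intro σ _
      simp
    · intro σ _
      exact (hinv σ).symm
  have fiber : ∀ s : Option ι ⊕ Option ι,
      ∑ σ : Perm (Option ι ⊕ Option ι) with σ⁻¹ (Sum.inl none) = s,
          ((Perm.sign σ : ℤ) : R) * ∏ i, A (σ (Sum.inl i)) (σ (Sum.inr i)) =
        ∑ σ : Perm (Option ι ⊕ Option ι) with σ (Sum.inl none) = Sum.inl none,
          ((Perm.sign σ : ℤ) : R) * ∏ i, A (σ (Sum.inl i)) (σ (Sum.inr i)) := by
    intro s
    have hiff : ∀ σ : Perm (Option ι ⊕ Option ι),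
        σ⁻¹ (Sum.inl none) = s ↔ σ s = Sum.inl none := fun σ => by
      rw [Perm.inv_eq_iff_eq, eq_comm]
    simp only [hiff]
    have left : ∀ j : Option ι, _ := fun j => transport (Sum.inl j) (Sum.inl none)
      (Perm.sumCongr (swap none j) (swap none j)) (by simp)
      (fun σ => pfSum_term_mul_sumCongr A σ _)
    rcases s with j | j
    · exact left j
    · rw [← left j]
      exact transport (Sum.inr j) (Sum.inl j) (swap (Sum.inl j) (Sum.inr j)) (by simp)
        (fun σ => pfSum_term_mul_swap A hA σ j)
  simp only [fiber, Finset.sum_const, Finset.card_univ, Fintype.card_sum, Fintype.card_option,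
    nsmul_eq_mul]
  push_cast
  ring

end PairedSum

section Pfaffian

open Equiv

/-- The equivalence sending `inl i` to `2 * i` and `inr i` to `2 * i + 1`. -/
def pairEquiv (N m : ℕ) (hN : N = 2 * m) : Fin m ⊕ Fin m ≃ Fin N :=
  Equiv.ofBijective
    (Sum.elim (fun i => ⟨2 * i.val, by omega⟩) (fun i => ⟨2 * i.val + 1, by omega⟩)) <| by
    constructor
    · rintro (⟨i, hi⟩ | ⟨i, hi⟩) (⟨j, hj⟩ | ⟨j, hj⟩) hij <;>
        simp only [Sum.elim_inl, Sum.elim_inr, Fin.mk.injEq, Sum.inl.injEq, Sum.inr.injEq,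
          reduceCtorEq] at hij ⊢ <;> omega
    · rintro ⟨x, hx⟩
      rcases Nat.even_or_odd' x with ⟨c, rfl | rfl⟩
      · exact ⟨Sum.inl ⟨c, by omega⟩, rfl⟩
      · exact ⟨Sum.inr ⟨c, by omega⟩, rfl⟩

lemma pairEquiv_inl (N m : ℕ) (hN : N = 2 * m) (i : Fin m) :
    pairEquiv N m hN (Sum.inl i) = ⟨2 * i.val, by omega⟩ := rfl

lemma pairEquiv_inr (N m : ℕ) (hN : N = 2 * m) (i : Fin m) :
    pairEquiv N m hN (Sum.inr i) = ⟨2 * i.val + 1, by omega⟩ := rfl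

/-- The Pfaffian of a rational skew-symmetric matrix of even order. -/
def pf {N : ℕ} (A : Fin N → Fin N → ℚ) : ℚ :=
  ((2 ^ (N / 2) * (N / 2).factorial : ℚ)⁻¹) *
    ∑ σ : Perm (Fin N), ((Perm.sign σ : ℤ) : ℚ) *
      ∏ i : Fin (N / 2), A (σ ⟨2 * i.val, by have := i.isLt; omega⟩)
        (σ ⟨2 * i.val + 1, by have := i.isLt; omega⟩)

lemma pfUpper_eq_pf (N : ℕ) (A : Fin N → Fin N → ℚ) : pfUpper N A = pf (skewExt A) := by
  simp only [pfUpper, pf, smul_eq_mul, zsmul_eq_mul]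

lemma pf_eq_pfSum {N m : ℕ} (hN : N = 2 * m) (A : Fin N → Fin N → ℚ) :
    pf A = ((2 ^ m * m.factorial : ℚ)⁻¹) *
      pfSum (fun u v => A (pairEquiv N m hN u) (pairEquiv N m hN v)) := by
  have hm : N / 2 = m := by omega
  have aux : ∀ m' (_ : N / 2 = m') (hN' : N = 2 * m'), pf A = ((2 ^ m' * m'.factorial : ℚ)⁻¹) *
      pfSum (fun u v => A (pairEquiv N m' hN' u) (pairEquiv N m' hN' v)) := by
    intro m' h' hN'
    subst h'
    unfold pf pfSum
    congr 1
    refine Fintype.sum_equiv (pairEquiv N _ hN').symm.permCongr _ _ fun σ => ?_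
    rw [Perm.sign_permCongr]
    congr 1
    refine Finset.prod_congr rfl fun i _ => ?_
    simp [Equiv.permCongr_apply, pairEquiv_inl, pairEquiv_inr]
  exact aux m hm hN

lemma pf_congruence {N : ℕ} (hN : Even N) (A : Fin N → Fin N → ℚ)
    (B : Matrix (Fin N) (Fin N) ℚ) :
    pf (fun i j => ∑ p, ∑ q, B i p * B j q * A p q) = B.det * pf A := by
  obtain ⟨m, hm⟩ := hN
  have hN : N = 2 * m := by omega
  rw [pf_eq_pfSum hN, pf_eq_pfSum hN, ← Matrix.det_submatrix_equiv_self (pairEquiv N m hN) B,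
    mul_left_comm, ← pfSum_congruence]
  simp only [← Equiv.sum_comp (pairEquiv N m hN), Matrix.submatrix_apply]

lemma pf_sum {N : ℕ} (hN : Even N) {α : Type*} (t : Fin N → Finset α) (w : Fin N → α → ℚ)
    (G : Fin N → Fin N → α → α → ℚ) :
    ∑ a ∈ Fintype.piFinset t, (∏ i, w i (a i)) * pf (fun i j => G i j (a i) (a j)) =
      pf (fun i j => ∑ x ∈ t i, ∑ y ∈ t j, w i x * w j y * G i j x y) := by
  obtain ⟨m, hm⟩ := hN
  have hN : N = 2 * m := by omega
  set e := pairEquiv N m hN with he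
  have key := pfSum_sum (fun v => t (e v)) (fun v => w (e v)) (fun u v => G (e u) (e v))
  simp only [pf_eq_pfSum hN]
  rw [← he]
  rw [← key, Finset.mul_sum]
  refine Finset.sum_nbij' (fun a v => a (e v)) (fun b i => b (e.symm i)) ?_ ?_ ?_ ?_ ?_
  · intro a ha
    simp only [Fintype.mem_piFinset] at ha ⊢
    exact fun v => ha _
  · intro b hb
    simp only [Fintype.mem_piFinset] at hb ⊢
    intro v
    simpa using hb (e.symm v)
  · intro a _
    simp
  · intro b _
    simp
  · intro a _
    rw [← Equiv.prod_comp e (fun v => w v (a v))]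
    rw [mul_left_comm]

/-- Expansion of a Pfaffian whose first row has a single nonzero entry, next to the diagonal. -/
lemma pf_expand {N : ℕ} (hN : Even N) (A : Fin (N + 2) → Fin (N + 2) → ℚ)
    (hA : ∀ i j, A i j = -A j i) (hrow : ∀ j, j ≠ 1 → A 0 j = 0) :
    pf A = A 0 1 * pf (fun i j : Fin N => A i.succ.succ j.succ.succ) := by
  obtain ⟨m, hm⟩ := hN
  have hN : N = 2 * m := by omega
  have hN' : N + 2 = 2 * (m + 1) := by omega
  rw [pf_eq_pfSum hN, pf_eq_pfSum hN', ← pfSum_reindex (finSuccEquiv m).symm, pfSum_option]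
  · have hrest : ∀ u : Fin m ⊕ Fin m, pairEquiv (N + 2) (m + 1) hN'
        (Sum.map (finSuccEquiv m).symm (finSuccEquiv m).symm (Sum.map some some u)) =
          (pairEquiv N m hN u).succ.succ := by
      rintro (u | u) <;> simp [pairEquiv_inl, pairEquiv_inr, Fin.ext_iff] <;> omega
    simp only [hrest]
    have h0 : pairEquiv (N + 2) (m + 1) hN' (Sum.inl 0) = 0 := rfl
    have h1 : pairEquiv (N + 2) (m + 1) hN' (Sum.inr 0) = 1 := rfl
    simp only [Sum.map_inl, Sum.map_inr, finSuccEquiv_symm_none, h0, h1, Fintype.card_fin]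
    rw [Nat.factorial_succ, pow_succ]
    have : (m.factorial : ℚ) ≠ 0 := by positivity
    push_cast
    field_simp
  · intro u v
    exact hA _ _
  · intro v hv
    refine hrow _ fun h => hv ?_
    have h1 : (1 : Fin (N + 2)) = pairEquiv (N + 2) (m + 1) hN' (Sum.inr 0) := rfl
    rw [h1] at h
    have h2 := (pairEquiv (N + 2) (m + 1) hN').injective h
    rcases v with v | v
    · simp at h2
    · simp only [Sum.map_inr, Sum.inr.injEq] at h2
      rw [Equiv.symm_apply_eq] at h2
      simp [h2]

/-- The Pfaffian of the sign matrix is `1`. -/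
lemma pf_sign_eq_one (m : ℕ) :
    pf (skewExt (fun _ _ : Fin (2 * m) => (1 : ℚ))) = 1 := by
  induction m with
  | zero => simp [pf]
  | succ m ih =>
    have hev : Even (2 * m) := even_two_mul m
    have hskew : ∀ i j : Fin (2 * m + 2),
        skewExt (fun _ _ => (1 : ℚ)) i j = -skewExt (fun _ _ => (1 : ℚ)) j i := by
      intro i j
      simp only [skewExt]
      split_ifs <;> first | simp | omega
    change pf (skewExt (fun _ _ : Fin (2 * m + 2) => (1 : ℚ))) = 1
    generalize hA : skewExt (fun _ _ : Fin (2 * m + 2) => (1 : ℚ)) = A at hskew ⊢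
    have hdet : (Matrix.transvection (0 : Fin (2 * m + 2)) 1 (-1 : ℚ)).det = 1 :=
      Matrix.det_transvection_of_ne _ _ (by simp) _
    have hent : ∀ i j, (∑ p, ∑ q, Matrix.transvection (0 : Fin (2 * m + 2)) 1 (-1 : ℚ) i p *
          Matrix.transvection (0 : Fin (2 * m + 2)) 1 (-1 : ℚ) j q * A p q) =
        A i j - (if i = 0 then A 1 j else 0) - (if j = 0 then A i 1 else 0)
          + (if i = 0 ∧ j = 0 then A 1 1 else 0) := by
      intro i j
      have hrow : ∀ (i : Fin (2 * m + 2)) (f : Fin (2 * m + 2) → ℚ),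
          ∑ p, Matrix.transvection (0 : Fin (2 * m + 2)) 1 (-1 : ℚ) i p * f p =
            f i - if i = 0 then f 1 else 0 := by
        intro i f
        simp only [Matrix.transvection, Matrix.add_apply, Matrix.one_apply, Matrix.single_apply,
          add_mul, Finset.sum_add_distrib, ite_mul, one_mul, zero_mul]
        rw [Finset.sum_ite_eq]
        by_cases hi : i = 0
        · simp [hi, sub_eq_add_neg]
        · simp [hi, Ne.symm hi]
      simp only [mul_assoc, ← Finset.mul_sum, hrow]
      by_cases hi : i = 0 <;> by_cases hj : j = 0 <;> simp [hi, hj] <;> ring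
    have key := pf_congruence (hev.add even_two) A (Matrix.transvection 0 1 (-1))
    rw [hdet, one_mul] at key
    rw [← key]
    simp only [hent]
    rw [pf_expand hev]
    · have hsub : (fun i j : Fin (2 * m) => A i.succ.succ j.succ.succ) =
          skewExt (fun _ _ : Fin (2 * m) => (1 : ℚ)) := by
        ext i j
        simp [← hA, skewExt]
      simp only [Fin.succ_ne_zero, false_and, if_false, sub_zero, add_zero]
      rw [hsub, ih]
      simp [← hA, skewExt]
    · intro i j
      have h11 : A 1 1 = 0 := by linarith [hskew 1 1]
      rw [hskew i j, hskew 1 j, hskew i 1]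
      by_cases hi : i = 0 <;> by_cases hj : j = 0 <;> simp [hi, hj, h11] <;> ring
    · intro j hj
      by_cases h0 : j = 0
      · subst h0
        rw [hskew 1 0]
        simp [← hA, skewExt]
      · have h1 : (0 : Fin (2 * m + 2)) < j := Fin.pos_of_ne_zero h0
        have h2 : (1 : Fin (2 * m + 2)) < j := by
          rw [Fin.lt_def]
          have e1 : ((1 : Fin (2 * m + 2)) : ℕ) = 1 := rfl
          have e0 : ((0 : Fin (2 * m + 2)) : ℕ) = 0 := rfl
          have := Fin.val_ne_of_ne h0
          have := Fin.val_ne_of_ne hj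
          omega
        simp [← hA, skewExt, h0, h1, h2]

end Pfaffian

section GTPolynomial

lemma qbinom_zero (x : ℚ) : qbinom x 0 = 1 := by simp [qbinom]

lemma qbinom_pascal (x : ℚ) (m : ℕ) : qbinom (x + 1) (m + 1) = qbinom x (m + 1) + qbinom x m := by
  have hfac : (m.factorial : ℚ) ≠ 0 := by positivity
  have hshift : ∏ j ∈ Finset.range m, (x + 1 - ((j + 1 : ℕ) : ℚ)) =
      ∏ j ∈ Finset.range m, (x - (j : ℚ)) :=
    Finset.prod_congr rfl fun j _ => by push_cast; ring
  rw [qbinom, qbinom, qbinom, Finset.prod_range_succ', Finset.prod_range_succ, hshift,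
    Nat.factorial_succ]
  push_cast
  field_simp
  ring

lemma qbinom_natCast_succ (m : ℕ) : qbinom (m : ℚ) (m + 1) = 0 := by
  rw [qbinom, Finset.prod_range_succ, sub_self, mul_zero, zero_div]

lemma qbinom_self (m : ℕ) : qbinom (m : ℚ) m = 1 := by
  induction m with
  | zero => simp [qbinom]
  | succ m ih =>
    rw [Nat.cast_succ, qbinom_pascal, ih, qbinom_natCast_succ, zero_add]

/-- The summand in the defining sum of `gt_h(x,y)`. -/
def gtTerm (h : ℕ) (x y p : ℤ) : ℚ :=
  qbinom ((x : ℚ) - (p : ℚ) + (h : ℚ) - 1) h * qbinom ((y : ℚ) - (p : ℚ) + (h : ℚ) - 2) h -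
    qbinom ((x : ℚ) - (p : ℚ) + (h : ℚ) - 2) h * qbinom ((y : ℚ) - (p : ℚ) + (h : ℚ) - 1) h

/-- The value of `gt_h` at integers. -/
def gtVal (gt : ℕ → MvPolynomial (Fin 2) ℚ) (h : ℕ) (x y : ℤ) : ℚ :=
  MvPolynomial.eval ![(x : ℚ), (y : ℚ)] (gt h)

lemma gtTerm_last (h : ℕ) (x y : ℤ) :
    gtTerm (h + 1) (x + 1) y x = qbinom ((y : ℚ) - x + h - 1) (h + 1) := by
  have h1 : ((x + 1 : ℤ) : ℚ) - x + ((h + 1 : ℕ) : ℚ) - 1 = ((h + 1 : ℕ) : ℚ) := by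
    push_cast; ring
  have h2 : ((x + 1 : ℤ) : ℚ) - x + ((h + 1 : ℕ) : ℚ) - 2 = ((h : ℕ) : ℚ) := by
    push_cast; ring
  have h3 : (y : ℚ) - x + ((h + 1 : ℕ) : ℚ) - 2 = (y : ℚ) - x + h - 1 := by
    push_cast; ring
  rw [gtTerm, h1, h2, h3, qbinom_self, qbinom_natCast_succ]
  ring

lemma gtVal_succ {gt : ℕ → MvPolynomial (Fin 2) ℚ} (hgt : gtChar gt) (h : ℕ) (x y : ℤ)
    (hx : (h : ℤ) + 1 ≤ x) :
    gtVal gt (h + 1) x y = ∑ p ∈ Finset.Icc ((h : ℤ) + 1) (x - 1), gtTerm (h + 1) x y p := by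
  have := hgt.2 (h + 1) (by omega) x y (by push_cast; exact hx)
  rw [gtVal, this]
  push_cast
  refine Finset.sum_congr rfl fun p _ => ?_
  simp only [gtTerm]
  push_cast
  rfl

lemma sum_Icc_last (f : ℤ → ℚ) (a x : ℤ) (hx : a ≤ x) :
    ∑ p ∈ Finset.Icc a x, f p = f x + ∑ p ∈ Finset.Icc a (x - 1), f p := by
  rw [← Finset.insert_Icc_sub_one_right_eq_Icc hx, Finset.sum_insert (by simp)]

lemma gtVal_succ_add_one {gt : ℕ → MvPolynomial (Fin 2) ℚ} (hgt : gtChar gt) (h : ℕ) (x y : ℤ)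
    (hx : (h : ℤ) + 1 ≤ x) :
    gtVal gt (h + 1) (x + 1) y = qbinom ((y : ℚ) - x + h - 1) (h + 1) +
      ∑ p ∈ Finset.Icc ((h : ℤ) + 1) (x - 1), gtTerm (h + 1) (x + 1) y p := by
  rw [gtVal_succ hgt h _ _ (by omega), add_sub_cancel_right, sum_Icc_last _ _ _ hx, gtTerm_last]

lemma gtVal_eq_shifted {gt : ℕ → MvPolynomial (Fin 2) ℚ} (hgt : gtChar gt) (h : ℕ) (x y : ℤ)
    (hx : (h : ℤ) + 1 ≤ x) :
    gtVal gt h x y = qbinom ((y : ℚ) - x + h - 1) h +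
      ∑ p ∈ Finset.Icc ((h : ℤ) + 1) (x - 1), gtTerm h x y (p - 1) := by
  cases h with
  | zero => simp [gtVal, hgt.1, gtTerm, qbinom_zero]
  | succ h =>
    push_cast at hx ⊢
    have hlast := gtTerm_last h (x - 1) y
    rw [sub_add_cancel] at hlast
    rw [gtVal_succ hgt h x y (by omega), sum_Icc_last _ _ _ (by omega), hlast]
    congr 1
    · congr 1
      push_cast
      ring
    · refine Finset.sum_nbij' (fun p => p + 1) (fun p => p - 1) ?_ ?_ ?_ ?_ ?_ <;>
        intro p hp <;> simp only [Finset.mem_Icc] at * <;> first | omega | simp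

lemma gtTerm_diff (h : ℕ) (x y p : ℤ) :
    gtTerm (h + 1) (x + 1) (y + 1) p - gtTerm (h + 1) x (y + 1) p - gtTerm (h + 1) (x + 1) y p
      + gtTerm (h + 1) x y p = gtTerm h x y (p - 1) := by
  have hX := qbinom_pascal ((x : ℚ) - p + h) h
  have hX' := qbinom_pascal ((x : ℚ) - p + h - 1) h
  have hY := qbinom_pascal ((y : ℚ) - p + h) h
  have hY' := qbinom_pascal ((y : ℚ) - p + h - 1) h
  simp only [gtTerm]
  push_cast
  ring_nf at hX hX' hY hY' ⊢
  rw [hX, hX', hY, hY']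
  ring

lemma gtVal_diff_of_le {gt : ℕ → MvPolynomial (Fin 2) ℚ} (hgt : gtChar gt) (h : ℕ) (x y : ℤ)
    (hx : (h : ℤ) + 1 ≤ x) :
    gtVal gt (h + 1) (x + 1) (y + 1) - gtVal gt (h + 1) x (y + 1) - gtVal gt (h + 1) (x + 1) y
      + gtVal gt (h + 1) x y = gtVal gt h x y := by
  rw [gtVal_succ_add_one hgt h x _ hx, gtVal_succ_add_one hgt h x _ hx, gtVal_succ hgt h x _ hx,
    gtVal_succ hgt h x _ hx, gtVal_eq_shifted hgt h x y hx]
  have hpas := qbinom_pascal ((y : ℚ) - x + h - 1) h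
  rw [← Finset.sum_congr rfl (fun p _ => gtTerm_diff h x y p), Finset.sum_add_distrib,
    Finset.sum_sub_distrib, Finset.sum_sub_distrib]
  have harg : ((y + 1 : ℤ) : ℚ) - x + h - 1 = (y : ℚ) - x + h - 1 + 1 := by push_cast; ring
  rw [harg, hpas]
  ring

lemma Polynomial.eval_aeval_mvPolynomial {σ : Type*} (f : σ → Polynomial ℚ)
    (g : MvPolynomial σ ℚ) (x : ℚ) :
    (MvPolynomial.aeval f g).eval x = MvPolynomial.eval (fun i => (f i).eval x) g := by
  induction g using MvPolynomial.induction_on with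
  | C a => simp
  | add p q hp hq => simp [hp, hq]
  | mul_X p i hp => simp [hp]

lemma Polynomial.eq_zero_of_eval_int_of_le (q : Polynomial ℚ) (c : ℤ)
    (hq : ∀ x : ℤ, c ≤ x → q.eval (x : ℚ) = 0) : q = 0 := by
  refine Polynomial.eq_zero_of_infinite_isRoot q ?_
  refine Set.infinite_of_injective_forall_mem (f := fun n : ℕ => ((c + n : ℤ) : ℚ)) ?_ ?_
  · intro a b hab
    simpa using hab
  · intro n
    exact hq _ (by omega)

lemma gtVal_diff {gt : ℕ → MvPolynomial (Fin 2) ℚ} (hgt : gtChar gt) (h : ℕ) (x y : ℤ) :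
    gtVal gt (h + 1) (x + 1) (y + 1) - gtVal gt (h + 1) x (y + 1) - gtVal gt (h + 1) (x + 1) y
      + gtVal gt (h + 1) x y = gtVal gt h x y := by
  let q : Polynomial ℚ :=
    aeval ![Polynomial.X + 1, Polynomial.C ((y : ℚ) + 1)] (gt (h + 1)) -
      aeval ![Polynomial.X, Polynomial.C ((y : ℚ) + 1)] (gt (h + 1)) -
      aeval ![Polynomial.X + 1, Polynomial.C (y : ℚ)] (gt (h + 1)) +
      aeval ![Polynomial.X, Polynomial.C (y : ℚ)] (gt (h + 1)) -
      aeval ![Polynomial.X, Polynomial.C (y : ℚ)] (gt h)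
  have hvec : ∀ (a b : Polynomial ℚ) (x : ℚ),
      (fun i => (![a, b] i).eval x) = ![a.eval x, b.eval x] := by
    intro a b x
    funext i
    fin_cases i <;> rfl
  have hq : ∀ x : ℤ, q.eval (x : ℚ) =
      gtVal gt (h + 1) (x + 1) (y + 1) - gtVal gt (h + 1) x (y + 1) - gtVal gt (h + 1) (x + 1) y
        + gtVal gt (h + 1) x y - gtVal gt h x y := by
    intro x
    simp only [q, Polynomial.eval_sub, Polynomial.eval_add, Polynomial.eval_aeval_mvPolynomial,
      hvec, gtVal, Polynomial.eval_X, Polynomial.eval_C, Polynomial.eval_one]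
    push_cast
    rfl
  have h0 : q = 0 := Polynomial.eq_zero_of_eval_int_of_le q (h + 1) fun x hx => by
    rw [hq, gtVal_diff_of_le hgt h x y hx, sub_self]
  have := hq x
  rw [h0, Polynomial.eval_zero] at this
  linarith

lemma gtVal_diag {gt : ℕ → MvPolynomial (Fin 2) ℚ} (hgt : gtChar gt) (h : ℕ) (x : ℤ) :
    gtVal gt (h + 1) x x = 0 := by
  let q : Polynomial ℚ := aeval (fun _ => Polynomial.X) (gt (h + 1))
  have hq : ∀ x : ℤ, q.eval (x : ℚ) = gtVal gt (h + 1) x x := by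
    intro x
    have hvec : (fun _ : Fin 2 => (x : ℚ)) = ![(x : ℚ), (x : ℚ)] := by
      funext i
      fin_cases i <;> rfl
    simp only [q, Polynomial.eval_aeval_mvPolynomial, gtVal, Polynomial.eval_X, hvec]
  have h0 : q = 0 := Polynomial.eq_zero_of_eval_int_of_le q (h + 1) fun x hx => by
    rw [hq, gtVal_succ hgt h x x hx]
    refine Finset.sum_eq_zero fun p _ => ?_
    rw [gtTerm]
    ring
  rw [← hq, h0, Polynomial.eval_zero]

/-- The `h`-fold forward difference of `gt_h(x,y)` in `y`. -/
def gtDiff (gt : ℕ → MvPolynomial (Fin 2) ℚ) (h : ℕ) (x y : ℤ) : ℚ :=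
  (fwdDiff 1)^[h] (fun y => gtVal gt h x y) y

lemma gtDiff_diff {gt : ℕ → MvPolynomial (Fin 2) ℚ} (hgt : gtChar gt) (h : ℕ) (x y : ℤ) :
    gtDiff gt (h + 1) (x + 1) y - gtDiff gt (h + 1) x y = gtDiff gt h x y := by
  simp only [gtDiff, Function.iterate_succ_apply]
  simp only [fwdDiff_iter_eq_sum_shift]
  rw [← Finset.sum_sub_distrib]
  refine Finset.sum_congr rfl fun j _ => ?_
  rw [← smul_sub]
  congr 1
  rw [← gtVal_diff hgt h x, fwdDiff, fwdDiff]
  ring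

lemma sum_Ico_diff (f : ℤ → ℚ) {a b : ℤ} (hab : a ≤ b) :
    ∑ x ∈ Finset.Ico a b, (f (x + 1) - f x) = f b - f a := by
  induction b, hab using Int.leInduction with
  | base => simp
  | succ b hb ih =>
    rw [← Finset.insert_Ico_right_eq_Ico_add_one hb, Finset.sum_insert (by simp), ih]
    ring

end GTPolynomial

section Trapezoids

/-- The trapezoids with prescribed bottom row. -/
def GTWithBottom (h n : ℕ) (k : Fin n → ℤ) : Type :=
  {a : GTIdx h n → ℤ //
    IsGT h n a ∧ ∀ i : Fin n, a (mkIdx h n h i.val le_rfl (by have := i.isLt; omega)) = k i}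

instance (n : ℕ) (k : Fin n → ℤ) : Unique (GTWithBottom 0 n k) where
  default := ⟨fun p => k ⟨p.1.2, by have := p.2.1; have := p.2.2; omega⟩,
    fun r c hr => absurd hr (by omega), fun i => rfl⟩
  uniq := by
    rintro ⟨a, ha, hk⟩
    refine Subtype.ext (funext ?_)
    rintro ⟨⟨r, c⟩, hr, hc⟩
    simp only [Nat.le_zero] at hr
    subst hr
    exact hk ⟨c, by simpa using hc⟩

/-- Adding a new bottom row to a trapezoidal array. -/
def glueBottom {h n : ℕ} (hhn : h ≤ n) (k : Fin (n + 1) → ℤ) (b : GTIdx h n → ℤ) :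
    GTIdx (h + 1) (n + 1) → ℤ := fun p =>
  if hr : p.1.1 ≤ h then b ⟨p.1, hr, by have := p.2.2; omega⟩
  else k ⟨p.1.2, by have := p.2.1; have := p.2.2; omega⟩

lemma glueBottom_of_le {h n : ℕ} (hhn : h ≤ n) (k : Fin (n + 1) → ℤ) (b : GTIdx h n → ℤ)
    {r c : ℕ} (hr : r ≤ h + 1) (hc : c < n + 1 - (h + 1) + r) (hr' : r ≤ h)
    (hc' : c < n - h + r) :
    glueBottom hhn k b (mkIdx (h + 1) (n + 1) r c hr hc) = b (mkIdx h n r c hr' hc') := by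
  simp [glueBottom, mkIdx, hr']

lemma glueBottom_last {h n : ℕ} (hhn : h ≤ n) (k : Fin (n + 1) → ℤ) (b : GTIdx h n → ℤ)
    {c : ℕ} (hr : h + 1 ≤ h + 1) (hc : c < n + 1 - (h + 1) + (h + 1)) (hc' : c < n + 1) :
    glueBottom hhn k b (mkIdx (h + 1) (n + 1) (h + 1) c hr hc) = k ⟨c, hc'⟩ := by
  simp [glueBottom, mkIdx]

/-- The rows interlacing with `k`. -/
def interlacing {n : ℕ} (k : Fin (n + 1) → ℤ) : Finset (Fin n → ℤ) :=
  Fintype.piFinset fun i => Finset.Icc (k i.castSucc) (k i.succ)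

/-- The trapezoid obtained from a row interlacing with `k` and a trapezoid above that row. -/
def glueTrapezoid {h n : ℕ} (hhn : h ≤ n) (k : Fin (n + 1) → ℤ)
    (s : Σ a : interlacing k, GTWithBottom h n a) : GTWithBottom (h + 1) (n + 1) k :=
  ⟨glueBottom hhn k s.2.1, by
    obtain ⟨⟨a, ha⟩, ⟨b, hb, hbot⟩⟩ := s
    simp only [interlacing, Fintype.mem_piFinset, Finset.mem_Icc] at ha
    constructor
    · intro r c hr hc
      rw [glueBottom_of_le hhn k b (r := r) _ _ (by omega) (by omega)]
      by_cases hrh : r < h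
      · rw [glueBottom_of_le hhn k b _ _ (by omega) (by omega),
          glueBottom_of_le hhn k b _ _ (by omega) (by omega)]
        exact hb r c hrh (by omega)
      · obtain rfl : r = h := by omega
        rw [glueBottom_last hhn k b _ _ (by omega), glueBottom_last hhn k b _ _ (by omega),
          hbot ⟨c, by omega⟩]
        exact ha ⟨c, by omega⟩
    · intro i
      exact glueBottom_last hhn k b _ _ i.isLt⟩

lemma glueTrapezoid_bijective {h n : ℕ} (hhn : h ≤ n) (k : Fin (n + 1) → ℤ) :
    Function.Bijective (glueTrapezoid hhn k) := by
  constructor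
  · rintro ⟨⟨a, ha⟩, ⟨b, hb, hbot⟩⟩ ⟨⟨a', ha'⟩, ⟨b', hb', hbot'⟩⟩ heq
    have hfun : glueBottom hhn k b = glueBottom hhn k b' := congrArg Subtype.val heq
    have hbb : b = b' := by
      funext p
      obtain ⟨⟨r, c⟩, hr, hc⟩ := p
      simp only at hr hc
      have := congrFun hfun (mkIdx (h + 1) (n + 1) r c (by omega) (by omega))
      rwa [glueBottom_of_le hhn k b _ _ hr hc, glueBottom_of_le hhn k b' _ _ hr hc] at this
    subst hbb
    have haa : a = a' := funext fun i => (hbot i).symm.trans (hbot' i)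
    subst haa
    rfl
  · rintro ⟨b, hb, hbot⟩
    refine ⟨⟨⟨fun i => b (mkIdx (h + 1) (n + 1) h i.val (by omega) (by omega)), ?_⟩,
      ⟨fun p => b (mkIdx (h + 1) (n + 1) p.1.1 p.1.2 (by have := p.2.1; omega)
        (by have := p.2.2; omega)), ?_, fun i => rfl⟩⟩, ?_⟩
    · simp only [interlacing, Fintype.mem_piFinset, Finset.mem_Icc]
      intro i
      rw [← hbot, ← hbot]
      exact hb h i.val (by omega) (by omega)
    · intro r c hr hc
      exact hb r c (by omega) (by omega)
    · refine Subtype.ext (funext ?_)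
      rintro ⟨⟨r, c⟩, hr, hc⟩
      simp only [glueTrapezoid, glueBottom]
      split_ifs with hrh
      · rfl
      · simp only at hr hrh hc
        obtain rfl : r = h + 1 := by omega
        rw [← hbot]
        rfl

lemma finite_GTWithBottom (h : ℕ) : ∀ (n : ℕ), h ≤ n → ∀ k : Fin n → ℤ,
    Finite (GTWithBottom h n k) := by
  induction h with
  | zero => intro n _ k; infer_instance
  | succ h ih =>
    intro n hn k
    obtain ⟨n, rfl⟩ : ∃ n', n = n' + 1 := ⟨n - 1, by omega⟩
    have := fun a : interlacing k => ih n (by omega) a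
    exact Finite.of_surjective _ (glueTrapezoid_bijective (by omega : h ≤ n) k).2

lemma GTcount_eq_card (h n : ℕ) (k : Fin n → ℤ) :
    GTcount h n k = Nat.card (GTWithBottom h n k) := rfl

lemma GTcount_zero (n : ℕ) (k : Fin n → ℤ) : GTcount 0 n k = 1 := by
  rw [GTcount_eq_card, Nat.card_unique]

lemma GTcount_succ {h n : ℕ} (hhn : h ≤ n) (k : Fin (n + 1) → ℤ) :
    GTcount (h + 1) (n + 1) k = ∑ a ∈ interlacing k, GTcount h n a := by
  have := fun a : interlacing k => finite_GTWithBottom h n hhn a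
  rw [GTcount_eq_card, ← Nat.card_eq_of_bijective _ (glueTrapezoid_bijective hhn k),
    Nat.card_sigma]
  exact Finset.sum_coe_sort (interlacing k) (fun a => GTcount h n a)

end Trapezoids

section Recursion

/-- Skew-symmetric extension of a family of entries depending on one parameter per index. -/
def skewFamily (E : ℕ → ℕ → ℤ → ℤ → ℚ) (i j : ℕ) (x y : ℤ) : ℚ :=
  if i < j then E i j x y else if j < i then -E j i y x else 0

lemma skewFamily_swap (E : ℕ → ℕ → ℤ → ℤ → ℚ) (i j : ℕ) (x y : ℤ) :
    skewFamily E i j x y = -skewFamily E j i y x := by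
  simp only [skewFamily]
  split_ifs <;> first | simp | omega

/-- The entries of the Pfaffian after taking the `h`-fold difference in the last variable. -/
def diffEntry (gt : ℕ → MvPolynomial (Fin 2) ℚ) (h n i j : ℕ) (x y : ℤ) : ℚ :=
  if i < n then
    if j < n then gtVal gt h x y
    else if j = n then gtDiff gt h x y
    else qbinom x (h - 1 - (j - (n + 1)))
  else 0

/-- The rows of the base change that turns the Pfaffian for `(h + 1, n + 1)` into the one for
`(h, n)`. -/
def baseChange (N n : ℕ) : ℕ → ℕ → ℚ
  | 0, p => if p = N + 1 then 1 else 0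
  | 1, p => if p = n then 1 else 0
  | i + 2, p => (if p = i + 1 then 1 else 0) - (if i < n ∧ p = i then 1 else 0)

lemma det_baseChange {N n : ℕ} (hN : Even N) (hn : n ≤ N) :
    (Matrix.of fun i p : Fin (N + 2) => baseChange N n i p).det = -1 := by
  rw [Matrix.det_succ_row_zero, Finset.sum_eq_single (Fin.last (N + 1))]
  · rw [Matrix.det_succ_row_zero, Finset.sum_eq_single (⟨n, by omega⟩ : Fin (N + 1))]
    · rw [Matrix.det_of_isUpperTriangular]
      · have hdiag : ∀ i : Fin N, baseChange N n (i + 2)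
            (((⟨n, by omega⟩ : Fin (N + 1)).succAbove i : Fin (N + 1)) : ℕ) =
              if (i : ℕ) < n then -1 else 1 := by
          intro i
          rw [baseChange]
          by_cases hi : (i : ℕ) < n
          · rw [Fin.succAbove_of_castSucc_lt _ _ (by simpa [Fin.lt_def] using hi)]
            simp [hi]
          · rw [Fin.succAbove_of_le_castSucc _ _ (by simpa [Fin.le_def] using hi)]
            simp [hi]
        have hprod : ∏ i : Fin N, (if (i : ℕ) < n then (-1 : ℚ) else 1) = (-1) ^ n := by
          rw [Fin.prod_univ_eq_prod_range (fun i => if i < n then (-1 : ℚ) else 1) N,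
            ← Finset.prod_filter, Finset.prod_const]
          congr 1
          have : (Finset.range N).filter (fun i => i < n) = Finset.range n := by
            ext i
            simp only [Finset.mem_filter, Finset.mem_range]
            omega
          rw [this, Finset.card_range]
        simp only [Matrix.submatrix_apply, Matrix.of_apply, Fin.val_succ, Fin.succAbove_last,
          Fin.val_castSucc, Fin.val_last, Fin.val_zero, hdiag, hprod]
        simp only [baseChange, if_true, mul_one]
        rw [← mul_pow]
        simp [pow_succ, hN.neg_one_pow]
      · intro i j hij
        have hij : (j : ℕ) < i := hij
        simp only [Matrix.submatrix_apply, Matrix.of_apply, Fin.val_succ, Fin.succAbove_last,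
          Fin.val_castSucc, baseChange]
        by_cases hj : (j : ℕ) < n
        · rw [Fin.succAbove_of_castSucc_lt _ _ (by simpa [Fin.lt_def] using hj)]
          simp only [Fin.val_castSucc]
          rw [if_neg (by omega), if_neg (by omega), sub_zero]
        · rw [Fin.succAbove_of_le_castSucc _ _ (by simpa [Fin.le_def] using hj)]
          simp only [Fin.val_succ]
          rw [if_neg (by omega), if_neg (by omega), sub_zero]
    · intro p _ hp
      have hp' : (p : ℕ) ≠ n := fun h => hp (Fin.ext h)
      simp [Matrix.submatrix_apply, baseChange, hp']
    · simp
  · intro p _ hp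
    have hp' : (p : ℕ) ≠ N + 1 := fun h => hp (Fin.ext h)
    simp [baseChange, hp']
  · simp

lemma sum_baseChange_zero (N n : ℕ) (f : ℕ → ℚ) :
    ∑ p : Fin (N + 2), baseChange N n 0 p * f p = f (N + 1) := by
  rw [Fin.sum_univ_eq_sum_range (fun p => baseChange N n 0 p * f p)]
  simp [baseChange]

lemma sum_baseChange_one {N n : ℕ} (hn : n ≤ N) (f : ℕ → ℚ) :
    ∑ p : Fin (N + 2), baseChange N n 1 p * f p = f n := by
  rw [Fin.sum_univ_eq_sum_range (fun p => baseChange N n 1 p * f p)]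
  simp only [baseChange, ite_mul, one_mul, zero_mul, Finset.sum_ite_eq', Finset.mem_range]
  rw [if_pos (by omega)]

lemma sum_baseChange_add_two {N n i : ℕ} (hi : i < N) (f : ℕ → ℚ) :
    ∑ p : Fin (N + 2), baseChange N n (i + 2) p * f p = f (i + 1) - if i < n then f i else 0 := by
  rw [Fin.sum_univ_eq_sum_range (fun p => baseChange N n (i + 2) p * f p)]
  simp only [baseChange, sub_mul, Finset.sum_sub_distrib, ite_mul, one_mul, zero_mul,
    Finset.sum_ite_eq', Finset.mem_range]
  rw [if_pos (by omega)]
  by_cases hin : i < n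
  · simp only [hin, true_and, Finset.sum_ite_eq', Finset.mem_range, if_true]
    rw [if_pos (by omega)]
  · simp [hin]

/-- The summation range of the variable with index `i` in the row above `L`. -/
def stepRange (n : ℕ) (L : ℕ → ℤ) (i : ℕ) : Finset ℤ :=
  if i < n then Finset.Ico (L i) (L (i + 1)) else {L (i + 1)}

lemma sum_stepRange_eq {gt : ℕ → MvPolynomial (Fin 2) ℚ} (hgt : gtChar gt) {h n i j : ℕ}
    {L : ℕ → ℤ} (hL : ∀ i < n, L i ≤ L (i + 1)) (hij : i < j) (hj : j < n + 1 + h)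
    {M : ℕ → ℕ → ℚ}
    (hM : ∀ p q, M p q = skewFamily (diffEntry gt (h + 1) (n + 1)) p q (L p) (L q)) :
    ∑ x ∈ stepRange n L i, ∑ y ∈ stepRange n L j, skewFamily (diffEntry gt h n) i j x y =
      (M (i + 1) (j + 1) - if j < n then M (i + 1) j else 0) -
        if i < n then M i (j + 1) - (if j < n then M i j else 0) else 0 := by
  simp only [skewFamily, hij, if_true]
  by_cases hi : i < n
  · by_cases hjn : j < n
    · have hV : ∀ p q, p ≤ q → q < n + 1 → M p q = gtVal gt (h + 1) (L p) (L q) := by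
        intro p q hpq hq
        rw [hM]
        rcases hpq.lt_or_eq with hlt | rfl
        · simp [skewFamily, diffEntry, hlt, hq, hlt.trans hq]
        · simp [skewFamily, gtVal_diag hgt]
      rw [hV _ _ (by omega) (by omega), hV _ _ (by omega) (by omega),
        hV _ _ (by omega) (by omega), hV _ _ (by omega) (by omega)]
      simp only [stepRange, diffEntry, hi, hjn, if_true]
      have inner : ∀ x : ℤ, ∑ y ∈ Finset.Ico (L j) (L (j + 1)), gtVal gt h x y =
          (gtVal gt (h + 1) (x + 1) (L (j + 1)) - gtVal gt (h + 1) (x + 1) (L j)) -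
            (gtVal gt (h + 1) x (L (j + 1)) - gtVal gt (h + 1) x (L j)) := by
        intro x
        have := sum_Ico_diff (fun y => gtVal gt (h + 1) (x + 1) y - gtVal gt (h + 1) x y)
          (hL j hjn)
        rw [Finset.sum_congr rfl (g := fun y => gtVal gt h x y)] at this
        · rw [this]; ring
        · intro y _
          linarith [gtVal_diff hgt h x y]
      simp only [inner]
      exact sum_Ico_diff
        (fun x => gtVal gt (h + 1) x (L (j + 1)) - gtVal gt (h + 1) x (L j)) (hL i hi)
    · simp only [stepRange, hi, hjn, if_true, if_false, Finset.sum_singleton, sub_zero, hM,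
        skewFamily, diffEntry]
      have hij1 : i + 1 < j + 1 := by omega
      have hij2 : i < j + 1 := by omega
      have hi1 : i + 1 < n + 1 := by omega
      have hi2 : i < n + 1 := by omega
      have hjn1 : ¬ j + 1 < n + 1 := by omega
      simp only [hij1, hij2, hi1, hi2, hjn1, if_true, if_false]
      by_cases hjeq : j = n
      · subst hjeq
        simp only [if_true]
        rw [Finset.sum_congr rfl fun x _ => (gtDiff_diff hgt h x (L (j + 1))).symm]
        exact sum_Ico_diff (fun x => gtDiff gt (h + 1) x (L (j + 1))) (hL i hi)
      · have hjeq1 : ¬ j + 1 = n + 1 := by omega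
        simp only [hjeq, hjeq1, if_false]
        have he : h + 1 - 1 - (j + 1 - (n + 1 + 1)) = (h - 1 - (j - (n + 1))) + 1 := by omega
        rw [he]
        have := sum_Ico_diff (fun x => qbinom (x : ℚ) ((h - 1 - (j - (n + 1))) + 1)) (hL i hi)
        rw [← this]
        refine Finset.sum_congr rfl fun x _ => ?_
        push_cast
        rw [qbinom_pascal]
        ring
  · have hjn : ¬ j < n := by omega
    simp only [hi, hjn, if_false, sub_zero, hM, skewFamily, diffEntry]
    rw [if_pos (by omega), if_neg (by omega)]
    simp

/-- Summation over the row above reduces the Pfaffian for `(h + 1, n + 1)` to the one for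
`(h, n)`. -/
lemma pf_step {gt : ℕ → MvPolynomial (Fin 2) ℚ} (hgt : gtChar gt) {h n N : ℕ}
    (hN : N = n + 1 + h) (hev : Even N) {L : ℕ → ℤ} (hL : ∀ i < n, L i ≤ L (i + 1)) :
    pf (fun i j : Fin (N + 2) =>
        skewFamily (diffEntry gt (h + 1) (n + 1)) i j (L i) (L j)) =
      pf (fun i j : Fin N => ∑ x ∈ stepRange n L i, ∑ y ∈ stepRange n L j,
        skewFamily (diffEntry gt h n) i j x y) := by
  obtain ⟨M, hM⟩ : ∃ M : ℕ → ℕ → ℚ,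
    ∀ p q, M p q = skewFamily (diffEntry gt (h + 1) (n + 1)) p q (L p) (L q) := ⟨_, fun _ _ => rfl⟩
  simp only [← hM]
  have hskew : ∀ p q, M p q = -M q p := fun p q => by rw [hM, hM, skewFamily_swap]
  have hlast : ∀ p, M (N + 1) p = if p < n + 1 then -1 else 0 := by
    intro p
    rw [hskew, hM]
    simp only [skewFamily, diffEntry]
    by_cases hp : p < n + 1
    · rw [if_pos (by omega), if_pos hp, if_neg (by omega), if_neg (by omega), if_pos hp]
      have : h + 1 - 1 - (N + 1 - (n + 1 + 1)) = 0 := by omega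
      rw [this, qbinom_zero]
    · rw [if_neg hp]
      split_ifs <;> first | omega | simp
  have hcong := pf_congruence (hev.add even_two) (fun p q : Fin (N + 2) => M p q)
    (Matrix.of fun i p : Fin (N + 2) => baseChange N n i p)
  rw [det_baseChange hev (by omega)] at hcong
  have hpf : pf (fun i j : Fin (N + 2) => M i j) = -pf (fun i j : Fin (N + 2) =>
      ∑ p : Fin (N + 2), baseChange N n i p * ∑ q : Fin (N + 2), baseChange N n j q * M p q) := by
    simp only [Matrix.of_apply, mul_assoc, ← Finset.mul_sum] at hcong
    rw [hcong]
    ring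
  rw [hpf, pf_expand hev]
  · have h01 : (∑ p : Fin (N + 2), baseChange N n ((0 : Fin (N + 2)) : ℕ) p *
        ∑ q : Fin (N + 2), baseChange N n ((1 : Fin (N + 2)) : ℕ) q * M p q) = -1 := by
      have e1 : ((1 : Fin (N + 2)) : ℕ) = 1 := rfl
      rw [e1, Fin.val_zero]
      simp only [sum_baseChange_one (by omega : n ≤ N) (M _)]
      rw [sum_baseChange_zero N n (fun p => M p n), hlast]
      simp
    rw [h01]
    simp only [neg_mul, one_mul, neg_neg]
    congr 1
    funext i j
    have hent : ∀ i j : Fin N, (∑ p : Fin (N + 2), baseChange N n (i + 2) p *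
        ∑ q : Fin (N + 2), baseChange N n (j + 2) q * M p q) =
          (M (i + 1) (j + 1) - if (j : ℕ) < n then M (i + 1) j else 0) -
            if (i : ℕ) < n then M i (j + 1) - (if (j : ℕ) < n then M i j else 0) else 0 := by
      intro i j
      simp only [sum_baseChange_add_two j.isLt (M _)]
      rw [sum_baseChange_add_two i.isLt
        (fun p => M p (j + 1) - if (j : ℕ) < n then M p j else 0)]
    simp only [Fin.val_succ, add_assoc, Nat.reduceAdd]
    rw [hent]
    rcases lt_trichotomy (i : ℕ) j with hij | hij | hij
    · rw [sum_stepRange_eq hgt hL hij (by omega) hM]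
    · have hzero : ∀ p, M p p = 0 := fun p => by linarith [hskew p p]
      rw [hij]
      simp only [skewFamily, lt_irrefl, if_false, Finset.sum_const_zero, hzero]
      rw [hskew (j + 1) j]
      split_ifs <;> ring
    · rw [Finset.sum_comm]
      simp only [fun x y => skewFamily_swap (diffEntry gt h n) i j x y, Finset.sum_neg_distrib]
      rw [sum_stepRange_eq hgt hL hij (by omega) hM, hskew (i + 1) (j + 1), hskew (i + 1) j,
        hskew i (j + 1), hskew i j]
      split_ifs <;> ring
  · intro i j
    simp only [Finset.mul_sum]
    rw [Finset.sum_comm, ← Finset.sum_neg_distrib]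
    refine Finset.sum_congr rfl fun p _ => ?_
    rw [← Finset.sum_neg_distrib]
    refine Finset.sum_congr rfl fun q _ => ?_
    rw [hskew]
    ring
  · intro j hj
    rw [Fin.val_zero,
      sum_baseChange_zero N n (fun p => ∑ q : Fin (N + 2), baseChange N n j q * M p q)]
    obtain ⟨j, hj'⟩ := j
    match j, hj' with
    | 0, _ =>
      rw [sum_baseChange_zero N n (M (N + 1)), hlast, if_neg (by omega)]
    | 1, _ => exact absurd rfl hj
    | j + 2, hj' =>
      rw [sum_baseChange_add_two (by omega) (M (N + 1)), hlast, hlast]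
      by_cases hjn : j < n
      · simp [hjn, show j < n + 1 by omega]
      · simp [hjn]

/-- The strictly increasing sequence attached to the row `k`, continued by the constant `y`. -/
def rowSeq {n : ℕ} (k : Fin n → ℤ) (y : ℤ) (i : ℕ) : ℤ :=
  if hi : i < n then k ⟨i, hi⟩ + i + 1 else y

lemma sum_interlacing_eq {n N : ℕ} (hN : n < N) (k : Fin (n + 1) → ℤ) (y : ℤ)
    (f : (Fin N → ℤ) → ℚ) :
    ∑ a ∈ interlacing k, f (fun i => rowSeq a y i) =
      ∑ b ∈ Fintype.piFinset (fun i : Fin N => stepRange n (rowSeq k y) i), f b := by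
  refine Finset.sum_nbij' (fun a i => rowSeq a y i)
    (fun b i => b ⟨i, by omega⟩ - i - 1) ?_ ?_ ?_ ?_ ?_
  · intro a ha
    simp only [interlacing, Fintype.mem_piFinset, Finset.mem_Icc] at ha ⊢
    intro i
    by_cases hi : (i : ℕ) < n
    · have := ha ⟨i, hi⟩
      simp only [Fin.castSucc_mk, Fin.succ_mk] at this
      simp only [stepRange, rowSeq, hi, if_true, Finset.mem_Ico, dif_pos, Nat.lt_succ_of_lt hi,
        Nat.succ_lt_succ hi]
      push_cast
      omega
    · simp [stepRange, rowSeq, hi]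
  · intro b hb
    simp only [interlacing, Fintype.mem_piFinset, Finset.mem_Icc] at hb ⊢
    intro i
    have := hb ⟨i, by omega⟩
    have hi := i.isLt
    simp only [stepRange, rowSeq, hi, if_true, Finset.mem_Ico, dif_pos, Nat.lt_succ_of_lt hi,
      Nat.succ_lt_succ hi] at this
    push_cast at this
    change k ⟨i, _⟩ ≤ _ ∧ _ ≤ k ⟨i + 1, _⟩
    omega
  · intro a _
    funext i
    simp only [rowSeq, i.isLt, dif_pos, Fin.eta]
    ring
  · intro b hb
    funext i
    by_cases hi : (i : ℕ) < n
    · simp only [rowSeq, hi, dif_pos, Fin.eta]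
      ring
    · have := Fintype.mem_piFinset.mp hb i
      simp [stepRange, rowSeq, hi] at this
      simp [rowSeq, hi, this]
  · intro a _
    rfl

lemma monotone_of_mem_interlacing {n : ℕ} {k : Fin (n + 1) → ℤ} {a : Fin n → ℤ}
    (ha : a ∈ interlacing k) : Monotone a := by
  simp only [interlacing, Fintype.mem_piFinset, Finset.mem_Icc] at ha
  cases n with
  | zero => exact fun i => i.elim0
  | succ n =>
    refine Fin.monotone_iff_le_succ.mpr fun i => ?_
    exact (ha i.castSucc).2.trans (ha i.succ).1

/-- The number of trapezoids as a rational Pfaffian. -/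
lemma GTcount_eq_pf {gt : ℕ → MvPolynomial (Fin 2) ℚ} (hgt : gtChar gt) (h : ℕ) :
    ∀ (n N : ℕ), h ≤ n → N = n + 1 + h → Even N → ∀ k : Fin n → ℤ, Monotone k → ∀ y : ℤ,
      (GTcount h n k : ℚ) = pf (fun i j : Fin N =>
        skewFamily (diffEntry gt h n) i j (rowSeq k y i) (rowSeq k y j)) := by
  induction h with
  | zero =>
    intro n N _ hN hev k _ y
    obtain ⟨m, hm⟩ := hev
    obtain rfl : N = 2 * m := by omega
    rw [GTcount_zero, Nat.cast_one, ← pf_sign_eq_one m]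
    congr 1
    funext i j
    have hone : ∀ i j : Fin (2 * m), i < j → ∀ x y, diffEntry gt 0 n i j x y = 1 := by
      intro i j hij x y
      have : (i : ℕ) < n := by have : (i : ℕ) < j := hij; omega
      simp only [diffEntry, this, if_true, gtVal, gtDiff, hgt.1]
      split_ifs <;> simp [qbinom_zero]
    simp only [skewExt, skewFamily, Fin.val_fin_lt]
    split_ifs with h1 h2
    · rw [hone i j h1]
    · rw [hone j i h2]
    · rfl
  | succ h ih =>
    intro n N hn hN hev k hk y
    obtain ⟨n, rfl⟩ : ∃ n', n = n' + 1 := ⟨n - 1, by omega⟩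
    obtain ⟨N, rfl⟩ : ∃ N', N = N' + 2 := ⟨N - 2, by omega⟩
    have hev' : Even N := by
      rw [Nat.even_iff] at hev ⊢
      omega
    have hL : ∀ i < n, rowSeq k y i ≤ rowSeq k y (i + 1) := by
      intro i hi
      simp only [rowSeq, Nat.lt_succ_of_lt hi, Nat.succ_lt_succ hi, dif_pos]
      have : k ⟨i, by omega⟩ ≤ k ⟨i + 1, by omega⟩ := hk (by simp)
      push_cast
      omega
    rw [GTcount_succ (by omega), Nat.cast_sum,
      Finset.sum_congr rfl fun a ha => ih n N (by omega) (by omega) hev' a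
        (monotone_of_mem_interlacing ha) y,
      pf_step hgt (by omega) hev' hL,
      sum_interlacing_eq (by omega : n < N) k y (fun b => pf (fun i j : Fin N =>
        skewFamily (diffEntry gt h n) i j (b i) (b j)))]
    have := pf_sum hev' (fun i : Fin N => stepRange n (rowSeq k y) i) (fun _ _ => 1)
      (fun i j => skewFamily (diffEntry gt h n) i j)
    simpa using this

end Recursion

section Evaluation

lemma fwdDiff_iterate_qbinom_eq_zero {e h : ℕ} (he : e < h) :
    (fwdDiff 1)^[h] (fun x : ℤ => qbinom (x : ℚ) e) = 0 := by
  induction h generalizing e with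
  | zero => omega
  | succ h ih =>
    rw [Function.iterate_succ_apply]
    cases e with
    | zero =>
      have hconst : fwdDiff 1 (fun x : ℤ => qbinom (x : ℚ) 0) = 0 := by
        funext x
        simp [fwdDiff, qbinom_zero]
      rw [hconst]
      exact Function.iterate_fixed (by funext x; simp [fwdDiff]) h
    | succ e =>
      have hdiff : fwdDiff 1 (fun x : ℤ => qbinom (x : ℚ) (e + 1)) =
          fun x : ℤ => qbinom (x : ℚ) e := by
        funext x
        simp only [fwdDiff]
        push_cast
        rw [qbinom_pascal]
        ring
      rw [hdiff, ih (by omega)]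

/-- Linearity of the Pfaffian in the row and column with index `a`. -/
lemma sum_mul_pf {N : ℕ} (hN : Even N) (a : Fin N) (s : Finset ℕ) (c : ℕ → ℚ)
    (G : Fin N → Fin N → ℕ → ℕ → ℚ) :
    ∑ x ∈ s, c x * pf (fun i j => G i j (if i = a then x else 0) (if j = a then x else 0)) =
      pf (fun i j => ∑ x ∈ (if i = a then s else {0}), ∑ y ∈ (if j = a then s else {0}),
        (if i = a then c x else 1) * (if j = a then c y else 1) * G i j x y) := by
  rw [← pf_sum hN (fun i => if i = a then s else {0}) (fun i x => if i = a then c x else 1) G]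
  refine Finset.sum_nbij' (fun x i => if i = a then x else 0) (fun b => b a) ?_ ?_ ?_ ?_ ?_
  · intro x hx
    refine Fintype.mem_piFinset.mpr fun i => ?_
    by_cases hi : i = a <;> simp [hi, hx]
  · intro b hb
    simpa using Fintype.mem_piFinset.mp hb a
  · intro x _
    simp
  · intro b hb
    funext i
    by_cases hi : i = a
    · simp [hi]
    · have := Fintype.mem_piFinset.mp hb i
      simp only [hi, if_false, Finset.mem_singleton] at this
      simp [hi, this]
  · intro x _
    congr 1
    rw [Finset.prod_eq_single a]
    · simp
    · intro i _ hi
      simp [hi]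
    · simp

/-- The entries of the Pfaffian at integer arguments. -/
def polyEntry (gt : ℕ → MvPolynomial (Fin 2) ℚ) (h n i j : ℕ) (x y : ℤ) : ℚ :=
  if i < n + 1 then
    if j < n + 1 then gtVal gt h x y else qbinom x (h - 1 - (j - (n + 1)))
  else 0

lemma fwdDiff_iterate_pf (gt : ℕ → MvPolynomial (Fin 2) ℚ) (h n : ℕ) (hev : Even (n + 1 + h))
    (k : Fin n → ℤ) (y : ℤ) :
    (fwdDiff 1)^[h] (fun y => pf (fun i j : Fin (n + 1 + h) =>
        skewFamily (polyEntry gt h n) i j (rowSeq k y i) (rowSeq k y j))) y =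
      pf (fun i j : Fin (n + 1 + h) =>
        skewFamily (diffEntry gt h n) i j (rowSeq k y i) (rowSeq k y j)) := by
  obtain ⟨a, ha⟩ : ∃ a : Fin (n + 1 + h), (a : ℕ) = n := ⟨⟨n, by omega⟩, rfl⟩
  obtain ⟨c, hc⟩ : ∃ c : ℕ → ℚ, ∀ x, c x = (-1) ^ (h - x) * (h.choose x : ℚ) := ⟨_, fun _ => rfl⟩
  have hfwd : ∀ (f : ℤ → ℚ) (y : ℤ),
      (fwdDiff 1)^[h] f y = ∑ x ∈ Finset.range (h + 1), c x * f (y + x) := by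
    intro f y
    rw [fwdDiff_iter_eq_sum_shift]
    refine Finset.sum_congr rfl fun x _ => ?_
    simp [hc, zsmul_eq_mul]
  have hrow : ∀ (x : ℕ) (i : Fin (n + 1 + h)), (i : ℕ) < n + 1 →
      rowSeq k (y + x) i = rowSeq k (y + ((if i = a then x else 0 : ℕ) : ℤ)) i := by
    intro x i hi
    by_cases hia : i = a
    · simp [hia]
    · have : (i : ℕ) < n := by
        have : (i : ℕ) ≠ n := fun h => hia (Fin.ext (h.trans ha.symm))
        omega
      simp [rowSeq, this]
  have hentry : ∀ (x : ℕ) (i j : Fin (n + 1 + h)),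
      skewFamily (polyEntry gt h n) i j (rowSeq k (y + x) i) (rowSeq k (y + x) j) =
        skewFamily (polyEntry gt h n) i j (rowSeq k (y + ((if i = a then x else 0 : ℕ) : ℤ)) i)
          (rowSeq k (y + ((if j = a then x else 0 : ℕ) : ℤ)) j) := by
    intro x i j
    simp only [skewFamily, polyEntry]
    by_cases hi : (i : ℕ) < n + 1 <;> by_cases hj : (j : ℕ) < n + 1 <;>
      simp only [hi, hj, if_true, if_false]
    · rw [hrow x i hi, hrow x j hj]
    · rw [hrow x i hi]
    · rw [hrow x j hj]
  rw [hfwd]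
  simp only [hentry]
  rw [sum_mul_pf hev a _ c (fun i j u v => skewFamily (polyEntry gt h n) i j
    (rowSeq k (y + (u : ℤ)) i) (rowSeq k (y + (v : ℤ)) j))]
  congr 1
  have hlt : ∀ i j : Fin (n + 1 + h), (i : ℕ) < j →
      ∑ u ∈ (if i = a then Finset.range (h + 1) else {0}),
        ∑ v ∈ (if j = a then Finset.range (h + 1) else {0}),
          (if i = a then c u else 1) * (if j = a then c v else 1) *
            polyEntry gt h n i j (rowSeq k (y + (u : ℤ)) i) (rowSeq k (y + (v : ℤ)) j) =
        diffEntry gt h n i j (rowSeq k y i) (rowSeq k y j) := by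
    intro i j hij
    by_cases hia : i = a
    · have hja : j ≠ a := fun h => by subst h hia; omega
      have hjn : ¬ (j : ℕ) < n + 1 := by rw [hia] at hij; omega
      have hin : (i : ℕ) = n := by rw [hia, ha]
      have he : h - 1 - ((j : ℕ) - (n + 1)) < h := by have := j.isLt; omega
      have := congrFun (fwdDiff_iterate_qbinom_eq_zero he) y
      rw [hfwd] at this
      simpa [hia, hja, hin, ha, polyEntry, diffEntry, hjn, rowSeq] using this
    · have hin : (i : ℕ) ≠ n := fun h => hia (Fin.ext (h.trans ha.symm))
      by_cases hja : j = a
      · have hi : (i : ℕ) < n := by rw [hja] at hij; omega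
        simp [hia, hja, ha, polyEntry, diffEntry, rowSeq, hi, Nat.lt_succ_of_lt hi, gtDiff, hfwd]
      · have hjn : (j : ℕ) ≠ n := fun h => hja (Fin.ext (h.trans ha.symm))
        have hi : (i : ℕ) < n + 1 ↔ (i : ℕ) < n := by omega
        have hj : (j : ℕ) < n + 1 ↔ (j : ℕ) < n := by omega
        simp [hia, hja, polyEntry, diffEntry, hi, hj, hjn]
  funext i j
  rcases lt_trichotomy (i : ℕ) j with hij | hij | hij
  · simp only [skewFamily, hij, if_true]
    exact hlt i j hij
  · simp [skewFamily, hij]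
  · simp only [skewFamily, hij, hij.not_gt, if_true, if_false]
    rw [← hlt j i hij, Finset.sum_comm, ← Finset.sum_neg_distrib]
    refine Finset.sum_congr rfl fun u _ => ?_
    rw [← Finset.sum_neg_distrib]
    refine Finset.sum_congr rfl fun v _ => ?_
    ring

lemma eval_shiftF {σ : Type*} [DecidableEq σ] (s : σ) (x : σ → ℚ) (p : MvPolynomial σ ℚ) :
    eval x (shiftF s p) = eval (fun t => if t = s then x t + 1 else x t) p := by
  induction p using MvPolynomial.induction_on with
  | C a => simp [shiftF]
  | add p q hp hq =>
    rw [shiftF] at hp hq ⊢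
    simp only [map_add, hp, hq]
  | mul_X p i hp =>
    rw [shiftF] at hp ⊢
    simp only [map_mul, hp, aeval_X, eval_X]
    split_ifs <;> simp

lemma eval_iterate_fdiffF {σ : Type*} [DecidableEq σ] (s : σ) (x : ℤ → σ → ℚ)
    (hx : ∀ m, x (m + 1) = fun t => if t = s then x m t + 1 else x m t) (h : ℕ)
    (p : MvPolynomial σ ℚ) (m : ℤ) :
    eval (x m) ((fdiffF s)^[h] p) = (fwdDiff 1)^[h] (fun m => eval (x m) p) m := by
  induction h generalizing m with
  | zero => rfl
  | succ h ih =>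
    rw [Function.iterate_succ_apply', Function.iterate_succ_apply', fdiffF, map_sub, eval_shiftF,
      ← hx, ih, ih, fwdDiff]

lemma eval_pfUpper {σ : Type*} (x : σ → ℚ) (N : ℕ) (A : Fin N → Fin N → MvPolynomial σ ℚ) :
    eval x (pfUpper N A) = pf (fun i j => skewExt (fun i j => eval x (A i j)) i j) := by
  have hskew : ∀ i j, eval x (skewExt A i j) = skewExt (fun i j => eval x (A i j)) i j := by
    intro i j
    simp only [skewExt]
    split_ifs <;> simp
  rw [← pfUpper_eq_pf]
  simp only [pfUpper, smul_eval, map_sum, map_zsmul, map_prod, hskew, smul_eq_mul]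

lemma eval_pbinom {σ : Type*} (x : σ → ℚ) (q : MvPolynomial σ ℚ) (m : ℕ) :
    eval x (pbinom q m) = qbinom (eval x q) m := by
  simp [pbinom, qbinom, smul_eval, map_prod, div_eq_inv_mul]

lemma eval_aeval_pair {σ : Type*} (x : σ → ℚ) (p q : MvPolynomial σ ℚ)
    (g : MvPolynomial (Fin 2) ℚ) :
    eval x (aeval ![p, q] g) = eval ![eval x p, eval x q] g := by
  induction g using MvPolynomial.induction_on with
  | C a => simp
  | add f g hf hg => simp only [map_add, hf, hg]
  | mul_X f i hf =>
    simp only [map_mul, hf, aeval_X, eval_X]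
    fin_cases i <;> rfl

end Evaluation

/-- For `h ≤ n` with `h + n` odd and weakly increasing integers
`k_1 ≤ … ≤ k_n`, let `F ∈ ℚ[k_1,…,k_{n+1}]` be the Pfaffian of the upper triangular array of
order `n+1+h` with entries `gt_h(k_i+i, k_j+j)`, `binom(k_i+i, h-j)` and `0`.  Then for every
integer value `m` of `k_{n+1}`, `GT_h(k_1,…,k_n) = (Δ_{k_{n+1}}^h F)(k_1,…,k_n,m)`. -/
theorem statement1 (h n : ℕ) (hhn : h ≤ n) (hodd : Odd (h + n))
    (k : Fin n → ℤ) (hk : Monotone k)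
    (gt : ℕ → MvPolynomial (Fin 2) ℚ) (hgt : gtChar gt) :
    ∀ m : ℤ,
      (GTcount h n k : ℚ) =
        MvPolynomial.eval
          (fun t : Fin (n+1) => if ht : (t : ℕ) < n then ((k ⟨(t : ℕ), ht⟩ : ℤ) : ℚ) else (m : ℚ))
          ((fdiffF (Fin.last n))^[h]
            (pfUpper (n + 1 + h) (fun a b =>
              if ha : (a : ℕ) < n + 1 then
                if hb : (b : ℕ) < n + 1 then
                  MvPolynomial.aeval
                    ![X (⟨(a : ℕ), ha⟩ : Fin (n+1)) + ((a : ℕ) : MvPolynomial (Fin (n+1)) ℚ) + 1,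
                      X (⟨(b : ℕ), hb⟩ : Fin (n+1)) + ((b : ℕ) : MvPolynomial (Fin (n+1)) ℚ) + 1]
                    (gt h)
                else
                  pbinom
                    (X (⟨(a : ℕ), ha⟩ : Fin (n+1)) + ((a : ℕ) : MvPolynomial (Fin (n+1)) ℚ) + 1)
                    (h - 1 - ((b : ℕ) - (n + 1)))
              else 0))) := by
  intro m
  have hev : Even (n + 1 + h) := by
    rw [Nat.odd_iff] at hodd
    rw [Nat.even_iff]
    omega
  rw [eval_iterate_fdiffF (Fin.last n)
    (fun (m : ℤ) (t : Fin (n + 1)) =>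
      if ht : (t : ℕ) < n then ((k ⟨(t : ℕ), ht⟩ : ℤ) : ℚ) else (m : ℚ))]
  · rw [GTcount_eq_pf hgt h n (n + 1 + h) hhn rfl hev k hk (m + n + 1),
      ← fwdDiff_iterate_pf gt h n hev k, fwdDiff_iter_eq_sum_shift, fwdDiff_iter_eq_sum_shift]
    refine Finset.sum_congr rfl fun u _ => ?_
    congr 1
    rw [eval_pfUpper]
    congr 1
    funext i j
    have hpt : ∀ (m : ℤ) (i : ℕ) (hi : i < n + 1),
        (if ht : i < n then ((k ⟨i, ht⟩ : ℤ) : ℚ) else (m : ℚ)) + i + 1 =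
          (rowSeq k (m + n + 1) i : ℚ) := by
      intro m i hi
      by_cases hin : i < n
      · simp [rowSeq, hin]
      · obtain rfl : i = n := by omega
        simp [rowSeq]
    have hshift : m + n + 1 + u • (1 : ℤ) = (m + u • 1) + n + 1 := by ring
    rw [hshift]
    simp only [skewExt, skewFamily, polyEntry, Fin.lt_def, gtVal]
    by_cases hi : (i : ℕ) < n + 1 <;> by_cases hj : (j : ℕ) < n + 1 <;>
      simp only [hi, hj, dif_pos, dif_neg, not_false_eq_true, if_true, if_false, eval_aeval_pair,
        eval_pbinom, map_add, eval_X, map_natCast, map_one, map_zero, hpt]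
  · intro m
    funext t
    by_cases ht : (t : ℕ) < n
    · have : t ≠ Fin.last n := fun h => by simp [h] at ht
      simp [ht, this]
    · have : t = Fin.last n := Fin.ext (by have := t.isLt; simp; omega)
      simp [this]
end
end

section
/- For every integer h ≥ 1, gt_h(x,y) + gt_h(y,x) = 2·sgt_h(x,y) as polynomials in x and y. -/
open MvPolynomial

noncomputable section

/-- The polynomial `sgt_h(x,y) = (-1)^h (1/(2h)!) (x-y-h+1)_{2h-1} (x-y)` (and `sgt_0 = 1`),
as a polynomial in the two variables `X 0 = x` and `X 1 = y`. -/
def sgtF (h : ℕ) : MvPolynomial (Fin 2) ℚ :=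
  if h = 0 then 1
  else ((-1 : ℚ) ^ h / (2 * h).factorial) •
    ((∏ j ∈ Finset.range (2 * h - 1),
        (X 0 - X 1 - (h : MvPolynomial (Fin 2) ℚ) + 1 + (j : MvPolynomial (Fin 2) ℚ))) *
      (X 0 - X 1))

theorem sum_choose_mul_choose (h m n : ℕ) :
    ∑ i ∈ Finset.range (n + 1), (i + h).choose h * (n - i).choose m =
      (n + h + 1).choose (h + m + 1) := by
  induction n generalizing m with
  | zero =>
    rcases m with _ | m
    · simp
    · simp [Nat.choose_eq_zero_of_lt (show h + 1 < h + (m + 1) + 1 by omega)]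
  | succ n ih =>
    rcases m with _ | m
    · simpa using Nat.sum_range_add_choose (n + 1) h
    · rw [Finset.sum_range_succ]
      have hstep : ∀ i ∈ Finset.range (n + 1),
          (i + h).choose h * (n + 1 - i).choose (m + 1) =
            (i + h).choose h * (n - i).choose m + (i + h).choose h * (n - i).choose (m + 1) := by
        intro i hi
        have hi' : i ≤ n := by simpa [Nat.lt_succ_iff] using hi
        rw [Nat.succ_sub hi', Nat.choose_succ_succ, mul_add]
      rw [Finset.sum_congr rfl hstep, Finset.sum_add_distrib, ih, ih,
        show n + 1 + h + 1 = (n + h + 1) + 1 by ring,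
        show h + (m + 1) + 1 = (h + m + 1) + 1 by ring, Nat.choose_succ_succ (n + h + 1)]
      simp

theorem qbinom_natCast (a m : ℕ) : qbinom a m = a.choose m := by
  rw [qbinom, ← descPochhammer_eval_eq_prod_range, descPochhammer_eval_eq_descFactorial,
    Nat.descFactorial_eq_factorial_mul_choose, Nat.cast_mul,
    mul_div_cancel_left₀ _ (Nat.cast_ne_zero.mpr m.factorial_ne_zero)]

theorem qbinom_sub_one_sub (m : ℕ) (z : ℚ) : qbinom (m - 1 - z) m = (-1) ^ m * qbinom z m := by
  rw [qbinom, qbinom, ← Finset.prod_range_reflect, ← mul_div_assoc]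
  congr 1
  rw [← Finset.card_range m, ← Finset.prod_const, Finset.card_range, ← Finset.prod_mul_distrib]
  refine Finset.prod_congr rfl fun j hj => ?_
  have hj' : j + 1 ≤ m := Finset.mem_range.mp hj
  rw [Nat.sub_sub, add_comm 1 j, Nat.cast_sub hj']
  push_cast
  ring

/-- The difference `C(n+h+1, 2h+1) - C(n+h-1, 2h+1)` as a convolution, for `h = k + 1`. -/
theorem sum_choose_mul_choose_sub (k n : ℕ) :
    ∑ i ∈ Finset.range n, (((i + (k + 1)).choose (k + 1) : ℚ) * (n - i).choose (k + 1) -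
        (i + k).choose (k + 1) * (n - 1 - i).choose (k + 1)) =
      (n + k + 1).choose (2 * k + 2) + (n + k).choose (2 * k + 2) := by
  rw [Finset.sum_sub_distrib]
  have h₁ : ∑ i ∈ Finset.range n, ((i + (k + 1)).choose (k + 1) : ℚ) * (n - i).choose (k + 1) =
      (n + k + 2).choose (2 * k + 3) := by
    have := sum_choose_mul_choose (k + 1) (k + 1) n
    rw [Finset.sum_range_succ, Nat.sub_self, Nat.choose_zero_succ, mul_zero, add_zero] at this
    rw [show n + k + 2 = n + (k + 1) + 1 by ring,
      show 2 * k + 3 = k + 1 + (k + 1) + 1 by ring, ← this]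
    push_cast
    rfl
  have h₂ : ∑ i ∈ Finset.range n, ((i + k).choose (k + 1) : ℚ) * (n - 1 - i).choose (k + 1) =
      (n + k).choose (2 * k + 3) := by
    rcases n with _ | _ | n
    · simp [Nat.choose_eq_zero_of_lt (show k < 2 * k + 3 by omega)]
    · simp [Nat.choose_eq_zero_of_lt (show 1 + k < 2 * k + 3 by omega)]
    · have := sum_choose_mul_choose (k + 1) (k + 1) n
      rw [Finset.sum_range_succ', zero_add k, Nat.choose_succ_self, Nat.cast_zero, zero_mul,
        add_zero, show n + 1 + 1 + k = n + (k + 1) + 1 by ring,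
        show 2 * k + 3 = k + 1 + (k + 1) + 1 by ring, ← this]
      push_cast
      refine Finset.sum_congr rfl fun i _ => ?_
      rw [show i + 1 + k = i + (k + 1) by ring]
  rw [h₁, h₂, Nat.choose_succ_succ (n + k + 1) (2 * k + 2), Nat.choose_succ_succ (n + k) (2 * k + 2)]
  push_cast
  ring

theorem choose_add_choose_eq_prod (k n : ℕ) :
    ((n + k + 1).choose (2 * k + 2) + (n + k).choose (2 * k + 2) : ℚ) =
      2 * ((∏ j ∈ Finset.range (2 * k + 1), ((n : ℚ) - k + j)) * n / (2 * k + 2).factorial) := by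
  have hrefl : ∏ j ∈ Finset.range (2 * k + 1), ((n : ℚ) - k + j) =
      ∏ j ∈ Finset.range (2 * k + 1), ((n : ℚ) + k - j) := by
    rw [← Finset.prod_range_reflect]
    refine Finset.prod_congr rfl fun j hj => ?_
    have hj' : j ≤ 2 * k := Nat.lt_succ_iff.mp (Finset.mem_range.mp hj)
    rw [Nat.add_sub_cancel, Nat.cast_sub hj']
    push_cast
    ring
  have h₁ : ∏ j ∈ Finset.range (2 * k + 2), (((n + k + 1 : ℕ) : ℚ) - j) =
      (∏ j ∈ Finset.range (2 * k + 1), ((n : ℚ) + k - j)) * (n + k + 1) := by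
    rw [Finset.prod_range_succ']
    push_cast
    congr 1
    · exact Finset.prod_congr rfl fun j _ => by ring
    · ring
  rw [← qbinom_natCast, ← qbinom_natCast, qbinom, qbinom, h₁,
    Finset.prod_range_succ _ (2 * k + 1), hrefl]
  push_cast
  ring

/-- The summand defining `gt_h`. -/
def gtSummand (h : ℕ) (x y p : ℚ) : ℚ :=
  qbinom (x - p + h - 1) h * qbinom (y - p + h - 2) h -
    qbinom (x - p + h - 2) h * qbinom (y - p + h - 1) h

theorem gtSummand_swap (h : ℕ) (x y p : ℚ) : gtSummand h y x p = -gtSummand h x y p := by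
  simp only [gtSummand]
  ring

theorem sum_Icc_int (f : ℤ → ℚ) (a : ℤ) (n : ℕ) :
    ∑ p ∈ Finset.Icc a (a + n - 1), f p = ∑ i ∈ Finset.range n, f (a + i) := by
  symm
  refine Finset.sum_bij (fun i _ => a + (i : ℤ)) ?_ ?_ ?_ ?_
  · intro i hi
    simp only [Finset.mem_range, Finset.mem_Icc] at hi ⊢
    omega
  · intro i _ j _ hij
    simpa using hij
  · intro p hp
    simp only [Finset.mem_Icc] at hp
    exact ⟨(p - a).toNat, by simp only [Finset.mem_range]; omega, by omega⟩
  · intros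
    rfl

theorem sum_gtSummand_range (k n : ℕ) (y : ℚ) :
    ∑ i ∈ Finset.range n, gtSummand (k + 1) (y + n) y (y + i) =
      2 * ((-1) ^ (k + 1) / (2 * k + 2).factorial *
        ((∏ j ∈ Finset.range (2 * k + 1), ((n : ℚ) - k + j)) * n)) := by
  have key := (sum_choose_mul_choose_sub k n).trans (choose_add_choose_eq_prod k n)
  trans (-1) ^ (k + 1) * (2 * ((∏ j ∈ Finset.range (2 * k + 1), ((n : ℚ) - k + j)) * n /
    (2 * k + 2).factorial))
  · rw [← key, Finset.mul_sum, ← Finset.sum_range_reflect]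
    refine Finset.sum_congr rfl fun i hi => ?_
    obtain ⟨d, rfl⟩ := Nat.exists_eq_add_of_lt (Finset.mem_range.mp hi)
    rw [show i + d + 1 - i = d + 1 by omega, show i + d + 1 - 1 - i = d by omega]
    simp only [← qbinom_natCast]
    have e₁ := qbinom_sub_one_sub (k + 1) ((d + 1 : ℕ) : ℚ)
    have e₂ := qbinom_sub_one_sub (k + 1) (d : ℚ)
    rw [gtSummand, mul_sub, mul_left_comm, ← e₁, mul_left_comm, ← e₂]
    push_cast
    congr 3 <;> ring
  · ring

theorem eval_sgtF (k : ℕ) (x y : ℚ) :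
    eval ![x, y] (sgtF (k + 1)) = (-1) ^ (k + 1) / (2 * k + 2).factorial *
      ((∏ j ∈ Finset.range (2 * k + 1), (x - y - k + j)) * (x - y)) := by
  rw [sgtF, if_neg k.succ_ne_zero, smul_eval, show 2 * (k + 1) = 2 * k + 2 by ring,
    show 2 * k + 2 - 1 = 2 * k + 1 by omega]
  simp only [map_mul, map_prod, map_add, map_sub, eval_X, map_natCast, map_one,
    Matrix.cons_val_zero, Matrix.cons_val_one]
  congr 2
  refine Finset.prod_congr rfl fun j _ => ?_
  push_cast
  ring

theorem eval_sgtF_swap (k : ℕ) (x y : ℚ) :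
    eval ![y, x] (sgtF (k + 1)) = eval ![x, y] (sgtF (k + 1)) := by
  rw [eval_sgtF, eval_sgtF]
  have hrefl : ∏ j ∈ Finset.range (2 * k + 1), (y - x - k + j) =
      -∏ j ∈ Finset.range (2 * k + 1), (x - y - k + j) := by
    rw [← Finset.prod_range_reflect, ← neg_one_mul,
      ← Odd.neg_one_pow (α := ℚ) (odd_two_mul_add_one k)]
    nth_rw 3 [← Finset.card_range (2 * k + 1)]
    rw [← Finset.prod_const, ← Finset.prod_mul_distrib]
    refine Finset.prod_congr rfl fun j hj => ?_
    have hj' : j ≤ 2 * k := Nat.lt_succ_iff.mp (Finset.mem_range.mp hj)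
    rw [Nat.add_sub_cancel, Nat.cast_sub hj']
    push_cast
    ring
  rw [hrefl]
  ring

theorem gtChar.eval_add_eval_swap {gt : ℕ → MvPolynomial (Fin 2) ℚ} (hgt : gtChar gt)
    (k b n : ℕ) :
    eval ![((k + 1 + b + n : ℕ) : ℚ), ((k + 1 + b : ℕ) : ℚ)] (gt (k + 1)) +
        eval ![((k + 1 + b : ℕ) : ℚ), ((k + 1 + b + n : ℕ) : ℚ)] (gt (k + 1)) =
      2 * eval ![((k + 1 + b + n : ℕ) : ℚ), ((k + 1 + b : ℕ) : ℚ)] (sgtF (k + 1)) := by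
  have hval (c : ℕ) (y : ℕ) :
      eval ![((k + 1 + c : ℕ) : ℚ), (y : ℚ)] (gt (k + 1)) =
        ∑ i ∈ Finset.range c,
          gtSummand (k + 1) ((k + 1 + c : ℕ) : ℚ) y (((k + 1 : ℕ) : ℚ) + i) := by
    have h₁ := hgt.2 (k + 1) (by omega) ((k + 1 + c : ℕ) : ℤ) (y : ℤ) (by omega)
    have h₂ := sum_Icc_int
      (fun p => gtSummand (k + 1) ((k + 1 + c : ℕ) : ℚ) y (p : ℚ)) ((k + 1 : ℕ) : ℤ) c
    simp only [gtSummand] at h₂ ⊢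
    rw [Nat.cast_add (k + 1) c] at h₁
    push_cast at h₁ h₂ ⊢
    rw [h₁, h₂]
  rw [hval b, add_assoc (k + 1) b n, hval (b + n), Finset.sum_range_add,
    Finset.sum_congr rfl fun i _ => gtSummand_swap (k + 1) ((k + 1 + (b + n) : ℕ) : ℚ) _ _,
    Finset.sum_neg_distrib, eval_sgtF]
  have h₃ := sum_gtSummand_range k n ((k + 1 + b : ℕ) : ℚ)
  have h₄ : ((k + 1 + (b + n) : ℕ) : ℚ) - ((k + 1 + b : ℕ) : ℚ) = n := by
    push_cast
    ring
  rw [h₄, ← h₃, add_neg_eq_iff_eq_add, add_comm]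
  congr 1
  refine Finset.sum_congr rfl fun i _ => ?_
  push_cast
  congr 1 <;> ring

/-- For every `h ≥ 1`, `gt_h(x,y) + gt_h(y,x) = 2 sgt_h(x,y)`
as polynomials in `x` and `y`. -/
theorem statement4 (gt : ℕ → MvPolynomial (Fin 2) ℚ) (hgt : gtChar gt) (h : ℕ) (hh : 1 ≤ h) :
    gt h + rename (⇑(Equiv.swap (0 : Fin 2) 1)) (gt h) = 2 • sgtF h := by
  obtain ⟨k, rfl⟩ := Nat.exists_eq_add_of_le' hh
  let s : Fin 2 → Set ℚ := fun _ => Set.range fun b : ℕ => ((k + 1 + b : ℕ) : ℚ)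
  have hs : ∀ i, (s i).Infinite := fun _ =>
    Set.infinite_range_of_injective fun a b hab => by simpa using hab
  refine funext_set s hs fun v hv => ?_
  obtain ⟨a, ha⟩ := hv 0 trivial
  obtain ⟨b, hb⟩ := hv 1 trivial
  have hv' : v = ![((k + 1 + a : ℕ) : ℚ), ((k + 1 + b : ℕ) : ℚ)] := by
    funext i
    fin_cases i
    · exact ha.symm
    · exact hb.symm
  have hswap (x y : ℚ) : (![x, y] : Fin 2 → ℚ) ∘ Equiv.swap (0 : Fin 2) 1 = ![y, x] := by
    funext i
    fin_cases i <;> simp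
  rw [hv', map_add, eval_rename, hswap, map_nsmul, nsmul_eq_mul, Nat.cast_ofNat]
  rcases le_total b a with hab | hab
  · obtain ⟨n, rfl⟩ := Nat.exists_eq_add_of_le hab
    simpa only [add_assoc] using hgt.eval_add_eval_swap k b n
  · obtain ⟨n, rfl⟩ := Nat.exists_eq_add_of_le hab
    rw [add_comm, ← eval_sgtF_swap]
    simpa only [add_assoc] using hgt.eval_add_eval_swap k a n
end
end
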